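/- arXiv:2310.07420 — 2 statements merged into one kernel-verified Lean document; each statement's English description precedes it below -/
import Mathlib

section
/- Let (X,d) be a complete geodesic metric space (not necessarily locally compact), H : X × ℝ × [0,∞) → ℝ continuous, and u : X → ℝ locally bounded. Then the following are equivalent: (i) u is a metric viscosity supersolution of H(x, u, |∇u|) = 0; (ii) for all â, b̂, x̂ ∈ X and k, c ≥ 0, if x ↦ u_*(x) + (k/2) d(â,x)² + c·d(b̂,x) attains a local minimum at x = x̂, then H^c(x̂, u_*(x̂), k·d(â,x̂)) ≥ 0; (iii) the same as (ii) with strict local minimum. -/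
open Filter Metric Set Topology

/-- Local slope of `u` at `x`, relative to a set `s` and a distance-like function `ρ`. -/
noncomputable def slopeWrt {α : Type*} [TopologicalSpace α] (s : Set α) (ρ : α → α → ℝ)
    (u : α → ℝ) (x : α) : ℝ :=
  Filter.limsup (fun y => |u y - u x| / ρ x y) (nhdsWithin x (s \ {x}))

/-- Upper local slope. -/
noncomputable def upperSlopeWrt {α : Type*} [TopologicalSpace α] (s : Set α) (ρ : α → α → ℝ)
    (u : α → ℝ) (x : α) : ℝ :=
  Filter.limsup (fun y => max (u y - u x) 0 / ρ x y) (nhdsWithin x (s \ {x}))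

/-- Lower local slope. -/
noncomputable def lowerSlopeWrt {α : Type*} [TopologicalSpace α] (s : Set α) (ρ : α → α → ℝ)
    (u : α → ℝ) (x : α) : ℝ :=
  Filter.limsup (fun y => max (u x - u y) 0 / ρ x y) (nhdsWithin x (s \ {x}))

/-- `u` is locally Lipschitz on `s` with respect to `ρ`. -/
def LocLipWrt {α : Type*} [TopologicalSpace α] (s : Set α) (ρ : α → α → ℝ)
    (u : α → ℝ) : Prop :=
  ∀ x ∈ s, ∃ K : ℝ, ∃ t ∈ nhdsWithin x s, ∀ y ∈ t ∩ s, ∀ z ∈ t ∩ s, |u y - u z| ≤ K * ρ y z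

/-- `u` is of class `C^{1,-}`: locally Lipschitz, with continuous local slope which
coincides with the lower local slope. -/
def IsC1MinusWrt {α : Type*} [TopologicalSpace α] (s : Set α) (ρ : α → α → ℝ)
    (u : α → ℝ) : Prop :=
  LocLipWrt s ρ u ∧ ContinuousOn (slopeWrt s ρ u) s ∧
    ∀ x ∈ s, lowerSlopeWrt s ρ u x = slopeWrt s ρ u x

/-- `u` is of class `C^{1,+}`: locally Lipschitz, with continuous local slope which
coincides with the upper local slope. -/
def IsC1PlusWrt {α : Type*} [TopologicalSpace α] (s : Set α) (ρ : α → α → ℝ)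
    (u : α → ℝ) : Prop :=
  LocLipWrt s ρ u ∧ ContinuousOn (slopeWrt s ρ u) s ∧
    ∀ x ∈ s, upperSlopeWrt s ρ u x = slopeWrt s ρ u x

/-- Upper semicontinuous envelope of `u` relative to `s`. -/
noncomputable def uscWrt {α : Type*} [TopologicalSpace α] (s : Set α) (u : α → ℝ) (x : α) : ℝ :=
  Filter.limsup u (nhdsWithin x s)

/-- Lower semicontinuous envelope of `u` relative to `s`. -/
noncomputable def lscWrt {α : Type*} [TopologicalSpace α] (s : Set α) (u : α → ℝ) (x : α) : ℝ :=
  Filter.liminf u (nhdsWithin x s)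

/-- `H_a(x,r,p) = inf { H x r q | q ≥ 0, |q - p| ≤ a }`. -/
noncomputable def Hlow {α : Type*} (H : α → ℝ → ℝ → ℝ) (a : ℝ) (x : α) (r p : ℝ) : ℝ :=
  sInf (H x r '' {q | 0 ≤ q ∧ |q - p| ≤ a})

/-- `H^a(x,r,p) = sup { H x r q | q ≥ 0, |q - p| ≤ a }`. -/
noncomputable def Hupp {α : Type*} (H : α → ℝ → ℝ → ℝ) (a : ℝ) (x : α) (r p : ℝ) : ℝ :=
  sSup (H x r '' {q | 0 ≤ q ∧ |q - p| ≤ a})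

/-- Metric viscosity subsolution of `H(x, u, |∇u|) = 0` on the space `(s, ρ)`. -/
def IsMVSubsolutionWrt {α : Type*} [TopologicalSpace α] (s : Set α) (ρ : α → α → ℝ)
    (H : α → ℝ → ℝ → ℝ) (u : α → ℝ) : Prop :=
  ∀ ψ₁ ψ₂ : α → ℝ, IsC1MinusWrt s ρ ψ₁ → LocLipWrt s ρ ψ₂ →
    ∀ x ∈ s, IsLocalMaxOn (fun y => uscWrt s u y - (ψ₁ y + ψ₂ y)) s x →
      Hlow H (uscWrt s (slopeWrt s ρ ψ₂) x) x (uscWrt s u x) (slopeWrt s ρ ψ₁ x) ≤ 0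

/-- Metric viscosity supersolution of `H(x, u, |∇u|) = 0` on the space `(s, ρ)`. -/
def IsMVSupersolutionWrt {α : Type*} [TopologicalSpace α] (s : Set α) (ρ : α → α → ℝ)
    (H : α → ℝ → ℝ → ℝ) (u : α → ℝ) : Prop :=
  ∀ ψ₁ ψ₂ : α → ℝ, IsC1PlusWrt s ρ ψ₁ → LocLipWrt s ρ ψ₂ →
    ∀ x ∈ s, IsLocalMinOn (fun y => lscWrt s u y - (ψ₁ y + ψ₂ y)) s x →
      0 ≤ Hupp H (uscWrt s (slopeWrt s ρ ψ₂) x) x (lscWrt s u x) (slopeWrt s ρ ψ₁ x)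

/-- `(s, ρ)` is a geodesic space: any two points are joined by an isometric
embedding of the interval `[0, ρ x y]`. -/
def IsGeodesicWrt {α : Type*} (s : Set α) (ρ : α → α → ℝ) : Prop :=
  ∀ x ∈ s, ∀ y ∈ s, ∃ γ : ℝ → α, γ 0 = x ∧ γ (ρ x y) = y ∧
    (∀ t ∈ Icc (0:ℝ) (ρ x y), γ t ∈ s) ∧
    ∀ t₁ ∈ Icc (0:ℝ) (ρ x y), ∀ t₂ ∈ Icc (0:ℝ) (ρ x y), ρ (γ t₁) (γ t₂) = |t₁ - t₂|

/-- Strict local maximum of `f` on `s` at `x`. -/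
def IsStrictLocalMaxOn' {α : Type*} [TopologicalSpace α] (f : α → ℝ) (s : Set α) (x : α) : Prop :=
  ∀ᶠ y in nhdsWithin x (s \ {x}), f y < f x

/-- Strict local minimum of `f` on `s` at `x`. -/
def IsStrictLocalMinOn' {α : Type*} [TopologicalSpace α] (f : α → ℝ) (s : Set α) (x : α) : Prop :=
  ∀ᶠ y in nhdsWithin x (s \ {x}), f x < f y

/-- `u` is locally bounded on `s`. -/
def LocBddWrt {α : Type*} [TopologicalSpace α] (s : Set α) (u : α → ℝ) : Prop :=
  ∀ x ∈ s, ∃ C : ℝ, ∀ᶠ y in nhdsWithin x s, |u y| ≤ C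

/-- `ρ` is a metric on the subset `S` of the ambient metric space `Y`, bounded below by the
ambient distance and inducing the subspace topology on `S`. -/
structure IsMetricOn {Y : Type*} [MetricSpace Y] (S : Set Y) (ρ : Y → Y → ℝ) : Prop where
  refl : ∀ x ∈ S, ρ x x = 0
  symm : ∀ x ∈ S, ∀ y ∈ S, ρ x y = ρ y x
  triangle : ∀ x ∈ S, ∀ y ∈ S, ∀ z ∈ S, ρ x z ≤ ρ x y + ρ y z
  ge_dist : ∀ x ∈ S, ∀ y ∈ S, dist x y ≤ ρ x y
  nhds_basis : ∀ x ∈ S, (nhdsWithin x S).HasBasis (fun ε : ℝ => 0 < ε)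
    (fun ε => {y | y ∈ S ∧ ρ x y < ε})

/-- Spatial local slope of `ψ : (0,∞) × X → ℝ` at `z = (t, x)`. -/
noncomputable def slopeSpWrt {α : Type*} [TopologicalSpace α] (s : Set α) (ρ : α → α → ℝ)
    (ψ : ℝ × α → ℝ) (z : ℝ × α) : ℝ :=
  Filter.limsup (fun y => |ψ (z.1, y) - ψ z| / ρ z.2 y) (nhdsWithin z.2 (s \ {z.2}))

/-- Spatial upper local slope. -/
noncomputable def upperSlopeSpWrt {α : Type*} [TopologicalSpace α] (s : Set α) (ρ : α → α → ℝ)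
    (ψ : ℝ × α → ℝ) (z : ℝ × α) : ℝ :=
  Filter.limsup (fun y => max (ψ (z.1, y) - ψ z) 0 / ρ z.2 y) (nhdsWithin z.2 (s \ {z.2}))

/-- Spatial lower local slope. -/
noncomputable def lowerSlopeSpWrt {α : Type*} [TopologicalSpace α] (s : Set α) (ρ : α → α → ℝ)
    (ψ : ℝ × α → ℝ) (z : ℝ × α) : ℝ :=
  Filter.limsup (fun y => max (ψ z - ψ (z.1, y)) 0 / ρ z.2 y) (nhdsWithin z.2 (s \ {z.2}))

/-- Product (max) metric on `ℝ × α` built from `ρ`. -/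
def prodMet {α : Type*} (ρ : α → α → ℝ) : ℝ × α → ℝ × α → ℝ :=
  fun z w => max |z.1 - w.1| (ρ z.2 w.2)

/-- Metric viscosity subsolution of `∂ₜ u + H(t, x, u, |∇u|) = 0` on `(0,∞) × (s, ρ)`. -/
def IsMVSubsolutionTWrt {α : Type*} [TopologicalSpace α] (s : Set α) (ρ : α → α → ℝ)
    (H : ℝ → α → ℝ → ℝ → ℝ) (u : ℝ × α → ℝ) : Prop :=
  ∀ ψ₁ ψ₂ dψ₁ dψ₂ : ℝ × α → ℝ,
    LocLipWrt (Ioi (0:ℝ) ×ˢ s) (prodMet ρ) ψ₁ →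
    LocLipWrt (Ioi (0:ℝ) ×ˢ s) (prodMet ρ) ψ₂ →
    (∀ z ∈ Ioi (0:ℝ) ×ˢ s, HasDerivAt (fun τ => ψ₁ (τ, z.2)) (dψ₁ z) z.1) →
    ContinuousOn dψ₁ (Ioi (0:ℝ) ×ˢ s) →
    (∀ z ∈ Ioi (0:ℝ) ×ˢ s, HasDerivAt (fun τ => ψ₂ (τ, z.2)) (dψ₂ z) z.1) →
    ContinuousOn dψ₂ (Ioi (0:ℝ) ×ˢ s) →
    ContinuousOn (slopeSpWrt s ρ ψ₁) (Ioi (0:ℝ) ×ˢ s) →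
    (∀ z ∈ Ioi (0:ℝ) ×ˢ s, lowerSlopeSpWrt s ρ ψ₁ z = slopeSpWrt s ρ ψ₁ z) →
    ∀ z ∈ Ioi (0:ℝ) ×ˢ s,
      IsLocalMaxOn (fun w => uscWrt (Ioi (0:ℝ) ×ˢ s) u w - (ψ₁ w + ψ₂ w))
        (Ioi (0:ℝ) ×ˢ s) z →
      dψ₁ z + dψ₂ z +
        Hlow (fun w : ℝ × α => H w.1 w.2)
          (uscWrt (Ioi (0:ℝ) ×ˢ s) (slopeSpWrt s ρ ψ₂) z) z
          (uscWrt (Ioi (0:ℝ) ×ˢ s) u z) (slopeSpWrt s ρ ψ₁ z) ≤ 0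

/-- Metric viscosity supersolution of `∂ₜ u + H(t, x, u, |∇u|) = 0` on `(0,∞) × (s, ρ)`. -/
def IsMVSupersolutionTWrt {α : Type*} [TopologicalSpace α] (s : Set α) (ρ : α → α → ℝ)
    (H : ℝ → α → ℝ → ℝ → ℝ) (u : ℝ × α → ℝ) : Prop :=
  ∀ ψ₁ ψ₂ dψ₁ dψ₂ : ℝ × α → ℝ,
    LocLipWrt (Ioi (0:ℝ) ×ˢ s) (prodMet ρ) ψ₁ →
    LocLipWrt (Ioi (0:ℝ) ×ˢ s) (prodMet ρ) ψ₂ →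
    (∀ z ∈ Ioi (0:ℝ) ×ˢ s, HasDerivAt (fun τ => ψ₁ (τ, z.2)) (dψ₁ z) z.1) →
    ContinuousOn dψ₁ (Ioi (0:ℝ) ×ˢ s) →
    (∀ z ∈ Ioi (0:ℝ) ×ˢ s, HasDerivAt (fun τ => ψ₂ (τ, z.2)) (dψ₂ z) z.1) →
    ContinuousOn dψ₂ (Ioi (0:ℝ) ×ˢ s) →
    ContinuousOn (slopeSpWrt s ρ ψ₁) (Ioi (0:ℝ) ×ˢ s) →
    (∀ z ∈ Ioi (0:ℝ) ×ˢ s, upperSlopeSpWrt s ρ ψ₁ z = slopeSpWrt s ρ ψ₁ z) →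
    ∀ z ∈ Ioi (0:ℝ) ×ˢ s,
      IsLocalMinOn (fun w => lscWrt (Ioi (0:ℝ) ×ˢ s) u w - (ψ₁ w + ψ₂ w))
        (Ioi (0:ℝ) ×ˢ s) z →
      0 ≤ dψ₁ z + dψ₂ z +
        Hupp (fun w : ℝ × α => H w.1 w.2)
          (uscWrt (Ioi (0:ℝ) ×ˢ s) (slopeSpWrt s ρ ψ₂) z) z
          (lscWrt (Ioi (0:ℝ) ×ˢ s) u z) (slopeSpWrt s ρ ψ₁ z)

section Limsup

variable {β : Type*} {l : Filter β} {f : β → ℝ}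

lemma Real.limsup_nonneg (h0 : ∀ x, 0 ≤ f x) : 0 ≤ limsup f l := by
  rcases l.eq_or_neBot with rfl | hl
  · simp [limsup_eq]
  · rw [limsup_eq]
    refine Real.sInf_nonneg fun a ha => ?_
    obtain ⟨x, hx⟩ := Eventually.exists ha
    exact (h0 x).trans hx

lemma Real.limsup_le_of_nonneg {C : ℝ} (hC : 0 ≤ C) (h0 : ∀ x, 0 ≤ f x)
    (h : ∀ᶠ x in l, f x ≤ C) : limsup f l ≤ C := by
  rcases l.eq_or_neBot with rfl | hl
  · simpa [limsup_eq] using hC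
  · rw [limsup_eq]
    refine csInf_le ⟨0, fun a ha => ?_⟩ h
    obtain ⟨x, hx⟩ := Eventually.exists ha
    exact (h0 x).trans hx

lemma Real.frequently_lt_of_lt_limsup {b : ℝ} (h0 : ∀ x, 0 ≤ f x) (hpos : 0 < limsup f l)
    (h : b < limsup f l) : ∃ᶠ x in l, b < f x := by
  rcases l.eq_or_neBot with rfl | hl
  · simp [limsup_eq] at hpos
  · exact Filter.frequently_lt_of_lt_limsup
      (IsCoboundedUnder.of_frequently_ge (a := 0) (Eventually.of_forall h0).frequently) h

end Limsup

section Ekeland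

/-- Ekeland's variational principle. -/
lemma LowerSemicontinuous.exists_ekeland {Y : Type*} [MetricSpace Y] [CompleteSpace Y]
    {f : Y → ℝ} (hf : LowerSemicontinuous f) {m : ℝ} (hm : ∀ y, m ≤ f y) {ε : ℝ} (hε : 0 < ε)
    (x₀ : Y) :
    ∃ x, f x + ε * dist x₀ x ≤ f x₀ ∧ ∀ y, f x ≤ f y + ε * dist x y := by
  set S : Y → Set Y := fun x => {y | f y + ε * dist x y ≤ f x} with hS
  have S_refl : ∀ x, x ∈ S x := fun x => by simp [hS]
  have S_trans : ∀ {x y z}, y ∈ S x → z ∈ S y → z ∈ S x := by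
    intro x y z hy hz
    simp only [hS, mem_ofPred_eq] at hy hz ⊢
    nlinarith [dist_triangle x y z]
  have bdd : ∀ x, BddBelow (f '' S x) := fun x => ⟨m, by rintro _ ⟨y, -, rfl⟩; exact hm y⟩
  have step : ∀ (n : ℕ) (x : Y), ∃ y ∈ S x, f y < sInf (f '' S x) + 1 / ((n : ℝ) + 1) := by
    intro n x
    obtain ⟨_, ⟨y, hy, rfl⟩, h⟩ := exists_lt_of_csInf_lt (s := f '' S x)
      ⟨f x, x, S_refl x, rfl⟩ (lt_add_of_pos_right _ (Nat.one_div_pos_of_nat (n := n)))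
    exact ⟨y, hy, h⟩
  choose g hgS hg using step
  let s : ℕ → Y := fun n => Nat.rec x₀ (fun n x => g n x) n
  have hs : ∀ n, s (n + 1) = g n (s n) := fun n => rfl
  have sS : ∀ n k, s (n + k) ∈ S (s n) := by
    intro n k
    induction k with
    | zero => exact S_refl _
    | succ k ih => exact S_trans ih (by rw [← add_assoc, hs]; exact hgS _ _)
  have sS' : ∀ {n k}, n ≤ k → s k ∈ S (s n) := by
    intro n k h
    obtain ⟨j, rfl⟩ := Nat.exists_eq_add_of_le h
    exact sS n j
  have anti : Antitone (f ∘ s) := fun n k h => by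
    have := sS' h
    simp only [hS, mem_ofPred_eq] at this
    have := mul_nonneg hε.le (dist_nonneg (x := s n) (y := s k))
    simp only [Function.comp]
    linarith
  have lim : Tendsto (f ∘ s) atTop (𝓝 (⨅ n, (f ∘ s) n)) :=
    tendsto_atTop_ciInf anti ⟨m, by rintro _ ⟨n, rfl⟩; exact hm _⟩
  have cau : CauchySeq s := by
    rw [Metric.cauchySeq_iff']
    intro δ hδ
    obtain ⟨N, hN⟩ := Metric.cauchySeq_iff'.1 lim.cauchySeq (ε * δ) (by positivity)
    refine ⟨N, fun n hn => ?_⟩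
    have h1 := sS' hn
    have h2 := hN n hn
    simp only [hS, mem_ofPred_eq] at h1
    rw [Real.dist_eq, abs_lt] at h2
    simp only [Function.comp] at h2
    rw [dist_comm]
    exact lt_of_mul_lt_mul_left (by linarith) hε.le
  obtain ⟨x, hx⟩ := cauchySeq_tendsto_of_complete cau
  have closed : ∀ z, IsClosed (S z) := by
    intro z
    have : LowerSemicontinuous fun y => f y + ε * dist z y :=
      hf.add (Continuous.lowerSemicontinuous (by fun_prop))
    exact this.isClosed_preimage (f z)
  have xS : ∀ n, x ∈ S (s n) := fun n =>
    (closed _).mem_of_tendsto hx (eventually_atTop.2 ⟨n, fun k hk => sS' hk⟩)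
  refine ⟨x, xS 0, fun y => ?_⟩
  by_contra! hy
  have hyS : y ∈ S x := hy.le
  have hfy : f x ≤ f y := by
    refine le_of_forall_pos_lt_add fun δ hδ => ?_
    obtain ⟨n, hn⟩ := exists_nat_one_div_lt hδ
    have h1 := hg n (s n)
    rw [← hs] at h1
    have h2 : sInf (f '' S (s n)) ≤ f y := csInf_le (bdd _) ⟨y, S_trans (xS n) hyS, rfl⟩
    have h3 : f x + ε * dist (s (n + 1)) x ≤ f (s (n + 1)) := xS (n + 1)
    have := mul_nonneg hε.le (dist_nonneg (x := s (n + 1)) (y := x))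
    linarith
  have := mul_nonneg hε.le (dist_nonneg (x := x) (y := y))
  linarith

end Ekeland

section Envelope

variable {X : Type*} [TopologicalSpace X] {u : X → ℝ}

lemma LocBddWrt.lowerSemicontinuous_lscWrt (hu : LocBddWrt univ u) :
    LowerSemicontinuous (lscWrt univ u) := by
  intro x b hb
  simp only [lscWrt, nhdsWithin_univ] at hb ⊢
  obtain ⟨b', hb1, hb2⟩ := exists_between hb
  obtain ⟨C, hC⟩ := hu x (mem_univ x)
  rw [nhdsWithin_univ] at hC
  have h := eventually_lt_of_lt_liminf hb2
    ⟨-C, eventually_map.2 (hC.mono fun y hy => (abs_le.1 hy).1)⟩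
  filter_upwards [(h.and hC).eventually_nhds] with y hy
  refine hb1.trans_le (le_liminf_of_le ?_ (hy.mono fun z hz => hz.1.le))
  exact IsCoboundedUnder.of_frequently_le (a := C)
    (hy.mono fun z hz => (abs_le.1 hz.2).2).frequently

end Envelope

section Hamiltonian

variable {X : Type*} [MetricSpace X] {H : X → ℝ → ℝ → ℝ}

lemma isCompact_slopeRange (a p : ℝ) : IsCompact {q : ℝ | 0 ≤ q ∧ |q - p| ≤ a} := by
  have : {q : ℝ | 0 ≤ q ∧ |q - p| ≤ a} = Ici 0 ∩ closedBall p a := by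
    ext q; simp [Real.dist_eq]
  rw [this]
  exact (isCompact_closedBall p a).inter_left isClosed_Ici

variable (hH : ContinuousOn (fun q : X × ℝ × ℝ => H q.1 q.2.1 q.2.2)
  ((univ : Set X) ×ˢ (univ : Set ℝ) ×ˢ Ici (0 : ℝ)))
include hH

lemma isCompact_image_slopeRange (a : ℝ) (x : X) (r p : ℝ) :
    IsCompact (H x r '' {q | 0 ≤ q ∧ |q - p| ≤ a}) := by
  refine (isCompact_slopeRange a p).image_of_continuousOn ?_
  exact hH.comp (f := fun q : ℝ => (x, r, q)) (by fun_prop) fun q hq => ⟨trivial, trivial, hq.1⟩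

lemma Hupp_mono {a a' : ℝ} (ha : 0 ≤ a) (h : a ≤ a') (x : X) (r : ℝ) {p : ℝ} (hp : 0 ≤ p) :
    Hupp H a x r p ≤ Hupp H a' x r p :=
  csSup_le_csSup (isCompact_image_slopeRange hH a' x r p).bddAbove
    ⟨H x r p, p, ⟨hp, by simpa using ha⟩, rfl⟩
    (image_mono fun _ hq => ⟨hq.1, hq.2.trans h⟩)

lemma Hupp_nonneg_of_approx {a : ℝ} {x : X} {r p : ℝ}
    (h : ∀ ε > 0, ∃ a' x' r' p', 0 ≤ a' ∧ 0 ≤ p' ∧ a' ≤ a + ε ∧ dist x' x ≤ ε ∧ |r' - r| ≤ ε ∧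
      |p' - p| ≤ ε ∧ 0 ≤ Hupp H a' x' r' p') :
    0 ≤ Hupp H a x r p := by
  have key : ∀ n : ℕ, ∃ x' r' q, 0 ≤ q ∧ |q - p| ≤ a + 2 * (1 / ((n : ℝ) + 1)) ∧
      dist x' x ≤ 1 / ((n : ℝ) + 1) ∧ |r' - r| ≤ 1 / ((n : ℝ) + 1) ∧ 0 ≤ H x' r' q := by
    intro n
    obtain ⟨a', x', r', p', ha', hp', haa, hx, hr, hpp, hh⟩ :=
      h (1 / ((n : ℝ) + 1)) Nat.one_div_pos_of_nat
    obtain ⟨q, hq, hqe⟩ := (isCompact_image_slopeRange hH a' x' r' p').sSup_mem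
      ⟨H x' r' p', p', ⟨hp', by simpa using ha'⟩, rfl⟩
    refine ⟨x', r', q, hq.1, ?_, hx, hr, hqe ▸ hh⟩
    linarith [abs_sub_le q p' p, hq.2]
  choose X' R Q hQ hQp hX hR hHn using key
  have lim0 : Tendsto (fun n : ℕ => 1 / ((n : ℝ) + 1)) atTop (𝓝 0) :=
    tendsto_one_div_add_atTop_nhds_zero_nat
  have limX : Tendsto X' atTop (𝓝 x) :=
    tendsto_iff_dist_tendsto_zero.2 (squeeze_zero (fun _ => dist_nonneg) hX lim0)
  have limR : Tendsto R atTop (𝓝 r) :=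
    tendsto_iff_dist_tendsto_zero.2 (squeeze_zero (fun _ => dist_nonneg) hR lim0)
  have hQK : ∀ n, Q n ∈ {q : ℝ | 0 ≤ q ∧ |q - p| ≤ a + 2} := fun n => by
    refine ⟨hQ n, (hQp n).trans ?_⟩
    have : 1 / ((n : ℝ) + 1) ≤ 1 := by
      rw [div_le_one (by positivity)]
      linarith [n.cast_nonneg (α := ℝ)]
    linarith
  obtain ⟨q, hq, φ, hφ, limQ⟩ := (isCompact_slopeRange (a + 2) p).tendsto_subseq hQK
  have hφ' := hφ.tendsto_atTop
  have hqa : |q - p| ≤ a := by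
    have h1 : Tendsto (fun n => |Q (φ n) - p|) atTop (𝓝 |q - p|) := (limQ.sub_const p).abs
    have h2 : Tendsto (fun n => a + 2 * (1 / ((φ n : ℝ) + 1))) atTop (𝓝 (a + 2 * 0)) :=
      ((lim0.comp hφ').const_mul 2).const_add a
    simpa using le_of_tendsto_of_tendsto' h1 h2 fun n => hQp (φ n)
  have limH : Tendsto (fun n => H (X' (φ n)) (R (φ n)) (Q (φ n))) atTop (𝓝 (H x r q)) := by
    have hc := hH (x, r, q) ⟨trivial, trivial, hq.1⟩
    refine hc.tendsto.comp (f := fun n => (X' (φ n), R (φ n), Q (φ n))) (tendsto_nhdsWithin_iff.2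
      ⟨(limX.comp hφ').prodMk_nhds ((limR.comp hφ').prodMk_nhds limQ), ?_⟩)
    exact Eventually.of_forall fun n => ⟨trivial, trivial, hQ (φ n)⟩
  exact (ge_of_tendsto' limH fun n => hHn (φ n)).trans
    (le_csSup (isCompact_image_slopeRange hH a x r p).bddAbove ⟨q, ⟨hq.1, hqa⟩, rfl⟩)

end Hamiltonian

section Slope

variable {X : Type*} [MetricSpace X] {f : X → ℝ}

lemma slopeWrt_nonneg (f : X → ℝ) (x : X) : 0 ≤ slopeWrt univ dist f x :=
  Real.limsup_nonneg fun _ => by positivity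

lemma slopeWrt_le {C : ℝ} (hC : 0 ≤ C) {x : X}
    (h : ∀ᶠ y in 𝓝[≠] x, |f y - f x| / dist x y ≤ C) : slopeWrt univ dist f x ≤ C := by
  rw [compl_eq_univ_sdiff] at h
  exact Real.limsup_le_of_nonneg hC (fun _ => by positivity) h

lemma LocLipWrt.exists_slope_bound (hf : LocLipWrt univ dist f) (x : X) :
    ∃ K, 0 ≤ K ∧ ∀ᶠ v in 𝓝 x, ∀ᶠ w in 𝓝[≠] v, |f w - f v| / dist v w ≤ K := by
  obtain ⟨K, t, ht, hK⟩ := hf x (mem_univ x)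
  rw [nhdsWithin_univ] at ht
  refine ⟨max K 0, le_max_right _ _, ?_⟩
  filter_upwards [eventually_eventually_nhds.2 ht] with v hv
  filter_upwards [hv.filter_mono nhdsWithin_le_nhds, self_mem_nhdsWithin] with w hw hne
  rw [div_le_iff₀ (dist_pos.2 (Ne.symm hne)), dist_comm]
  exact (hK w ⟨hw, trivial⟩ v ⟨mem_of_mem_nhds hv, trivial⟩).trans
    (mul_le_mul_of_nonneg_right (le_max_left _ _) dist_nonneg)

lemma LocLipWrt.eventually_lt_of_slopeWrt_lt (hf : LocLipWrt univ dist f) {x : X} {K : ℝ}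
    (h : slopeWrt univ dist f x < K) : ∀ᶠ y in 𝓝[≠] x, |f y - f x| / dist x y < K := by
  obtain ⟨C, -, hC⟩ := hf.exists_slope_bound x
  have hCx := hC.self_of_nhds
  rw [compl_eq_univ_sdiff] at hCx ⊢
  exact eventually_lt_of_limsup_lt h ⟨C, eventually_map.2 hCx⟩

lemma LocLipWrt.eventually_slopeWrt_lt (hf : LocLipWrt univ dist f) {x : X} {K : ℝ}
    (h : uscWrt univ (slopeWrt univ dist f) x < K) :
    ∀ᶠ y in 𝓝 x, slopeWrt univ dist f y < K := by
  obtain ⟨C, hC0, hC⟩ := hf.exists_slope_bound x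
  rw [uscWrt, nhdsWithin_univ] at h
  exact eventually_lt_of_limsup_lt h
    ⟨C, eventually_map.2 (hC.mono fun v hv => slopeWrt_le hC0 hv)⟩

lemma continuousOn_of_isometry {γ : ℝ → X} {D : ℝ}
    (hγ : ∀ s ∈ Icc 0 D, ∀ t ∈ Icc 0 D, dist (γ s) (γ t) = |s - t|) :
    ContinuousOn γ (Icc 0 D) := by
  refine LipschitzOnWith.continuousOn (K := 1) (LipschitzOnWith.of_dist_le_mul fun s hs t ht => ?_)
  rw [hγ s hs t ht, Real.dist_eq]
  simp

lemma tendsto_nhdsNE_of_isometry {γ : ℝ → X} {D : ℝ}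
    (hγ : ∀ s ∈ Icc 0 D, ∀ t ∈ Icc 0 D, dist (γ s) (γ t) = |s - t|) {t : ℝ} (ht : t ∈ Ico 0 D) :
    Tendsto γ (𝓝[>] t) (𝓝[≠] (γ t)) := by
  have htI : t ∈ Icc 0 D := Ico_subset_Icc_self ht
  have hIoc : Ioc t D ∈ 𝓝[>] t := Ioc_mem_nhdsGT ht.2
  refine tendsto_nhdsWithin_iff.2 ⟨?_, ?_⟩
  · exact (continuousOn_of_isometry hγ t htI).tendsto.mono_left
      (le_inf inf_le_left (le_principal_iff.2
        (mem_of_superset hIoc fun s hs => ⟨ht.1.trans hs.1.le, hs.2⟩)))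
  · filter_upwards [hIoc] with s hs heq
    have := hγ s ⟨ht.1.trans hs.1.le, hs.2⟩ t htI
    rw [show γ s = γ t from heq, dist_self, eq_comm, abs_eq_zero] at this
    linarith [hs.1]

/-- On a geodesic space, a locally Lipschitz function whose slope is less than `K` near `x` is
`K`-Lipschitz near `x`. -/
lemma LocLipWrt.exists_ball_lipschitz (hgeo : IsGeodesicWrt (univ : Set X) dist)
    (hf : LocLipWrt univ dist f) {x : X} {K : ℝ}
    (h : ∀ᶠ y in 𝓝 x, slopeWrt univ dist f y < K) :
    ∃ R > 0, ∀ y ∈ ball x R, ∀ z ∈ ball x R, f z - f y ≤ K * dist y z := by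
  obtain ⟨R, hR, hball⟩ := Metric.eventually_nhds_iff_ball.1 h
  have cont : Continuous f := continuous_iff_continuousAt.2 fun v => by
    obtain ⟨C, t, ht, hC⟩ := hf v (mem_univ v)
    rw [nhdsWithin_univ] at ht
    refine tendsto_iff_dist_tendsto_zero.2 ?_
    have : Tendsto (fun w => C * dist w v) (𝓝 v) (𝓝 0) := by
      have : Continuous fun w => C * dist w v := by fun_prop
      simpa using this.tendsto v
    refine squeeze_zero' (Eventually.of_forall fun _ => dist_nonneg) ?_ this
    filter_upwards [ht] with w hw
    exact hC w ⟨hw, trivial⟩ v ⟨mem_of_mem_nhds ht, trivial⟩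
  refine ⟨R / 3, by positivity, fun y hy z hz => ?_⟩
  obtain ⟨γ, h0, h1, -, hγ⟩ := hgeo y trivial z trivial
  set D := dist y z
  have hD : 0 ≤ D := dist_nonneg
  have hDR : D < 2 * (R / 3) := by
    have := dist_triangle_right y z x
    rw [mem_ball] at hy hz
    linarith
  have main := image_le_of_liminf_slope_right_le_deriv_boundary (f := f ∘ γ) (a := 0) (b := D)
    (B := fun t => f y + K * t) (B' := fun _ => K) (cont.comp_continuousOn (continuousOn_of_isometry hγ))
    (by simp [h0]) (by fun_prop)
    (fun t _ => by simpa using (((hasDerivAt_id t).const_mul K).const_add (f y)).hasDerivWithinAt)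
    ?_ (right_mem_Icc.2 hD)
  · simp only [Function.comp, h1] at main
    linarith
  intro t ht r hr
  have htI : t ∈ Icc 0 D := Ico_subset_Icc_self ht
  have hmem : γ t ∈ ball x R := by
    have h2 := hγ t htI 0 ⟨le_rfl, hD⟩
    rw [h0, sub_zero, abs_of_nonneg ht.1] at h2
    have := dist_triangle (γ t) y x
    rw [mem_ball] at hy ⊢
    linarith [ht.2]
  have hlim := tendsto_nhdsNE_of_isometry hγ ht
  refine Eventually.frequently ?_
  filter_upwards [hlim.eventually (hf.eventually_lt_of_slopeWrt_lt (hball _ hmem)),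
    Ioc_mem_nhdsGT ht.2] with s hs hst
  rw [hγ t htI s ⟨ht.1.trans hst.1.le, hst.2⟩, abs_sub_comm t s,
    abs_of_pos (sub_pos.2 hst.1)] at hs
  rw [slope_def_field]
  refine lt_of_le_of_lt ?_ (hs.trans hr)
  exact div_le_div_of_nonneg_right (le_abs_self _) (sub_pos.2 hst.1).le

end Slope

section TestFunctions

variable {X : Type*} [MetricSpace X]

lemma abs_half_sq_dist_sub_le {k : ℝ} (hk : 0 ≤ k) (a y z : X) :
    |-(k / 2 * dist a y ^ 2) - -(k / 2 * dist a z ^ 2)| ≤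
      k / 2 * (dist a y + dist a z) * dist y z := by
  have h : -(k / 2 * dist a y ^ 2) - -(k / 2 * dist a z ^ 2) =
      k / 2 * (dist a y + dist a z) * (dist a z - dist a y) := by ring
  rw [h, abs_mul, abs_of_nonneg (by positivity : 0 ≤ k / 2 * (dist a y + dist a z))]
  refine mul_le_mul_of_nonneg_left ?_ (by positivity)
  rw [dist_comm a z, dist_comm a y, dist_comm y z]
  exact abs_dist_sub_le z y a

lemma locLipWrt_neg_half_sq_dist {k : ℝ} (hk : 0 ≤ k) (a : X) :
    LocLipWrt univ dist fun y => -(k / 2 * dist a y ^ 2) := by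
  intro x _
  refine ⟨k * (dist a x + 1), ball x 1, by
    rw [nhdsWithin_univ]; exact ball_mem_nhds x one_pos, fun y hy z hz => ?_⟩
  refine (abs_half_sq_dist_sub_le hk a y z).trans
    (mul_le_mul_of_nonneg_right ?_ dist_nonneg)
  have h1 : dist a y ≤ dist a x + 1 := by
    linarith [dist_triangle_right a y x, mem_ball.1 hy.1]
  have h2 : dist a z ≤ dist a x + 1 := by
    linarith [dist_triangle_right a z x, mem_ball.1 hz.1]
  nlinarith

lemma eventually_slope_half_sq_dist_le {k : ℝ} (hk : 0 ≤ k) (a x : X) {ε : ℝ} (hε : 0 < ε) :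
    ∀ᶠ y in 𝓝[≠] x,
      |-(k / 2 * dist a y ^ 2) - -(k / 2 * dist a x ^ 2)| / dist x y ≤ k * dist a x + ε := by
  have hc : Continuous fun y => k / 2 * (dist a y + dist a x) := by fun_prop
  have hlt : k / 2 * (dist a x + dist a x) < k * dist a x + ε := by linarith
  filter_upwards [(hc.continuousAt.eventually_lt_const hlt).filter_mono nhdsWithin_le_nhds,
    self_mem_nhdsWithin] with y hy hne
  rw [div_le_iff₀ (dist_pos.2 (Ne.symm hne)), dist_comm x y]
  exact (abs_half_sq_dist_sub_le hk a y x).trans (mul_le_mul_of_nonneg_right hy.le dist_nonneg)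

lemma slopeWrt_half_sq_dist_le {k : ℝ} (hk : 0 ≤ k) (a x : X) :
    slopeWrt univ dist (fun y => -(k / 2 * dist a y ^ 2)) x ≤ k * dist a x :=
  le_of_forall_pos_le_add fun ε hε =>
    slopeWrt_le (by positivity) (eventually_slope_half_sq_dist_le hk a x hε)

lemma LocLipWrt.upperSlopeWrt_le_slopeWrt {f : X → ℝ} (hf : LocLipWrt univ dist f) (x : X) :
    upperSlopeWrt univ dist f x ≤ slopeWrt univ dist f x := by
  refine le_of_forall_pos_le_add fun ε hε => ?_
  have h := hf.eventually_lt_of_slopeWrt_lt (lt_add_of_pos_right (slopeWrt univ dist f x) hε)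
  rw [compl_eq_univ_sdiff] at h
  refine Real.limsup_le_of_nonneg (add_nonneg (slopeWrt_nonneg f x) hε.le)
    (fun _ => by positivity) (h.mono fun y hy => le_trans ?_ hy.le)
  exact div_le_div_of_nonneg_right (max_le (le_abs_self _) (abs_nonneg _)) dist_nonneg

lemma le_upperSlopeWrt_half_sq_dist (hgeo : IsGeodesicWrt (univ : Set X) dist)
    {k : ℝ} (hk : 0 ≤ k) (a x : X) :
    k * dist a x ≤ upperSlopeWrt univ dist (fun y => -(k / 2 * dist a y ^ 2)) x := by
  rcases eq_or_ne a x with rfl | hne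
  · rw [dist_self, mul_zero]
    exact Real.limsup_nonneg fun _ => by positivity
  obtain ⟨γ, h0, h1, -, hγ⟩ := hgeo x trivial a trivial
  have hD : 0 < dist x a := dist_pos.2 hne.symm
  have hlim := tendsto_nhdsNE_of_isometry hγ ⟨le_rfl, hD⟩
  rw [h0, compl_eq_univ_sdiff] at hlim
  refine le_of_forall_pos_le_add fun ε hε => ?_
  rw [← sub_le_iff_le_add]
  refine le_limsup_of_frequently_le (hlim.frequently (Eventually.frequently ?_)) ?_
  · have hc : Continuous fun t : ℝ => k * dist x a - k / 2 * t := by fun_prop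
    have hlt : k * dist x a - ε < k * dist x a - k / 2 * 0 := by linarith
    filter_upwards [Ioc_mem_nhdsGT hD,
      (hc.continuousAt.eventually_const_lt hlt).filter_mono nhdsWithin_le_nhds] with t ht hlt
    have htI : t ∈ Icc 0 (dist x a) := ⟨ht.1.le, ht.2⟩
    have e1 : dist x (γ t) = t := by
      have := hγ 0 ⟨le_rfl, hD.le⟩ t htI
      rwa [h0, zero_sub, abs_neg, abs_of_pos ht.1] at this
    have e2 : dist a (γ t) = dist x a - t := by
      have := hγ (dist x a) ⟨hD.le, le_rfl⟩ t htI
      rwa [h1, abs_of_nonneg (sub_nonneg.2 ht.2)] at this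
    rw [e1, e2, dist_comm a x, le_div_iff₀ ht.1]
    refine le_trans ?_ (le_max_left _ _)
    nlinarith [mul_le_mul_of_nonneg_right hlt.le ht.1.le]
  · refine ⟨k * dist a x + 1, eventually_map.2 ?_⟩
    have h := eventually_slope_half_sq_dist_le hk a x one_pos
    rw [compl_eq_univ_sdiff] at h
    refine h.mono fun y hy => le_trans ?_ hy
    exact div_le_div_of_nonneg_right (max_le (le_abs_self _) (abs_nonneg _)) dist_nonneg

lemma slopeWrt_half_sq_dist (hgeo : IsGeodesicWrt (univ : Set X) dist)
    {k : ℝ} (hk : 0 ≤ k) (a x : X) :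
    slopeWrt univ dist (fun y => -(k / 2 * dist a y ^ 2)) x = k * dist a x :=
  (slopeWrt_half_sq_dist_le hk a x).antisymm ((le_upperSlopeWrt_half_sq_dist hgeo hk a x).trans
    ((locLipWrt_neg_half_sq_dist hk a).upperSlopeWrt_le_slopeWrt x))

lemma isC1PlusWrt_neg_half_sq_dist (hgeo : IsGeodesicWrt (univ : Set X) dist)
    {k : ℝ} (hk : 0 ≤ k) (a : X) :
    IsC1PlusWrt univ dist fun y => -(k / 2 * dist a y ^ 2) := by
  have hlip := locLipWrt_neg_half_sq_dist hk a
  refine ⟨hlip, ?_, fun x _ => (hlip.upperSlopeWrt_le_slopeWrt x).antisymm ?_⟩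
  · rw [funext (slopeWrt_half_sq_dist hgeo hk a)]
    fun_prop
  · rw [slopeWrt_half_sq_dist hgeo hk a]
    exact le_upperSlopeWrt_half_sq_dist hgeo hk a x

lemma abs_neg_mul_dist_sub_le {c : ℝ} (hc : 0 ≤ c) (b y z : X) :
    |-(c * dist b y) - -(c * dist b z)| ≤ c * dist y z := by
  have h : -(c * dist b y) - -(c * dist b z) = c * (dist b z - dist b y) := by ring
  rw [h, abs_mul, abs_of_nonneg hc, dist_comm b z, dist_comm b y, dist_comm y z]
  exact mul_le_mul_of_nonneg_left (abs_dist_sub_le z y b) hc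

lemma locLipWrt_neg_mul_dist {c : ℝ} (hc : 0 ≤ c) (b : X) :
    LocLipWrt univ dist fun y => -(c * dist b y) :=
  fun _ _ => ⟨c, univ, univ_mem, fun y _ z _ => abs_neg_mul_dist_sub_le hc b y z⟩

lemma uscWrt_slopeWrt_nonneg (f : X → ℝ) (x : X) :
    0 ≤ uscWrt univ (slopeWrt univ dist f) x :=
  Real.limsup_nonneg (slopeWrt_nonneg f)

lemma uscWrt_slopeWrt_neg_mul_dist_le {c : ℝ} (hc : 0 ≤ c) (b x : X) :
    uscWrt univ (slopeWrt univ dist fun y => -(c * dist b y)) x ≤ c := by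
  refine Real.limsup_le_of_nonneg hc (slopeWrt_nonneg _) (Eventually.of_forall fun v => ?_)
  refine slopeWrt_le hc ?_
  filter_upwards [self_mem_nhdsWithin] with y hy
  rw [div_le_iff₀ (dist_pos.2 (Ne.symm hy)), dist_comm v y]
  exact abs_neg_mul_dist_sub_le hc b y v

end TestFunctions

section Characterization

variable {X : Type*} [MetricSpace X] {H : X → ℝ → ℝ → ℝ} {u : X → ℝ}

lemma IsMVSupersolutionWrt.hupp_nonneg (hgeo : IsGeodesicWrt (univ : Set X) dist)
    (hH : ContinuousOn (fun q : X × ℝ × ℝ => H q.1 q.2.1 q.2.2)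
      ((univ : Set X) ×ˢ (univ : Set ℝ) ×ˢ Ici (0 : ℝ)))
    (hu : IsMVSupersolutionWrt univ dist H u) {a b x : X} {k c : ℝ} (hk : 0 ≤ k) (hc : 0 ≤ c)
    (hmin : IsLocalMin (fun x => lscWrt univ u x + (k / 2 * dist a x ^ 2 + c * dist b x)) x) :
    0 ≤ Hupp H c x (lscWrt univ u x) (k * dist a x) := by
  have h := hu _ _ (isC1PlusWrt_neg_half_sq_dist hgeo hk a) (locLipWrt_neg_mul_dist hc b) x trivial
    (by
      rw [IsLocalMinOn, nhdsWithin_univ]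
      filter_upwards [hmin] with y hy
      linarith)
  rw [slopeWrt_half_sq_dist hgeo hk] at h
  exact h.trans (Hupp_mono hH (uscWrt_slopeWrt_nonneg _ _)
    (uscWrt_slopeWrt_neg_mul_dist_le hc b x) x _ (by positivity))

lemma hupp_nonneg_of_strict
    (hH : ContinuousOn (fun q : X × ℝ × ℝ => H q.1 q.2.1 q.2.2)
      ((univ : Set X) ×ˢ (univ : Set ℝ) ×ˢ Ici (0 : ℝ)))
    {v : X → ℝ}
    (hv : ∀ a b x : X, ∀ k c : ℝ, 0 ≤ k → 0 ≤ c →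
      IsStrictLocalMinOn' (fun x => v x + (k / 2 * dist a x ^ 2 + c * dist b x)) univ x →
      0 ≤ Hupp H c x (v x) (k * dist a x))
    {a b x : X} {k c : ℝ} (hk : 0 ≤ k) (hc : 0 ≤ c)
    (hmin : IsLocalMin (fun x => v x + (k / 2 * dist a x ^ 2 + c * dist b x)) x) :
    0 ≤ Hupp H c x (v x) (k * dist a x) := by
  refine Hupp_nonneg_of_approx hH fun ε hε => ⟨c + ε, x, v x, k * dist a x, by positivity,
    by positivity, le_rfl, by simp [hε.le], by simp [hε.le], by simp [hε.le],
    hv a x x k (c + ε) hk (by positivity) ?_⟩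
  rw [IsStrictLocalMinOn', ← compl_eq_univ_sdiff]
  filter_upwards [hmin.filter_mono nhdsWithin_le_nhds, self_mem_nhdsWithin] with y hy hne
  have h1 : 0 < ε * dist x y := mul_pos hε (dist_pos.2 (Ne.symm hne))
  have h2 : c * dist b y ≤ c * dist b x + c * dist x y := by
    rw [← mul_add]
    exact mul_le_mul_of_nonneg_left (dist_triangle b x y) hc
  rw [dist_self]
  linarith

lemma IsC1PlusWrt.exists_far_growth {f : X → ℝ} (hf : IsC1PlusWrt univ dist f) {x : X}
    (hp : 0 < slopeWrt univ dist f x) {ε δ : ℝ} (hε : 0 < ε) (hεp : ε < slopeWrt univ dist f x)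
    (hδ : 0 < δ) :
    ∃ y, 0 < dist y x ∧ dist y x < δ ∧
      (slopeWrt univ dist f x - ε) * dist y x ≤ f y - f x := by
  have heq := hf.2.2 x trivial
  have hfreq := Real.frequently_lt_of_lt_limsup (fun _ => by positivity)
    (show 0 < upperSlopeWrt univ dist f x from heq ▸ hp)
    (show slopeWrt univ dist f x - ε < upperSlopeWrt univ dist f x by rw [heq]; linarith)
  rw [← compl_eq_univ_sdiff] at hfreq
  obtain ⟨y, hy, hball, hne⟩ := (hfreq.and_eventually
    (inter_mem (mem_nhdsWithin_of_mem_nhds (ball_mem_nhds x hδ)) self_mem_nhdsWithin)).exists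
  have hpos : 0 < dist y x := dist_pos.2 hne
  refine ⟨y, hpos, hball, ?_⟩
  rw [dist_comm x y, lt_div_iff₀ hpos] at hy
  rcases max_choice (f y - f x) 0 with h | h <;> rw [h] at hy
  · exact hy.le
  · nlinarith [mul_pos (sub_pos.2 hεp) hpos]

/-- Localized Ekeland principle: an almost minimizer of `g` on a closed ball can be moved to an
interior local minimizer of a conical perturbation of `g`. -/
lemma LowerSemicontinuous.exists_isLocalMin_add_dist [CompleteSpace X] {g : X → ℝ}
    (hg : LowerSemicontinuous g) {x : X} {r α η : ℝ} (hα : 0 < α) (hη : 0 ≤ η) (hηr : η < r)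
    (hgx : ∀ z ∈ closedBall x r, g x - α * η ≤ g z) :
    ∃ x', dist x' x ≤ η ∧ g x' ≤ g x ∧ IsLocalMin (fun z => g z + α * dist x' z) x' := by
  have : CompleteSpace (closedBall x r) := isClosed_closedBall.completeSpace_coe
  obtain ⟨⟨x', hx'⟩, h1, h2⟩ := LowerSemicontinuous.exists_ekeland
    (f := fun z : closedBall x r => g z) (hg.comp continuous_subtype_val)
    (fun z => hgx z z.2) hα ⟨x, mem_closedBall_self (hη.trans hηr.le)⟩
  change g x' + α * dist x x' ≤ g x at h1
  have hd : dist x' x ≤ η := by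
    rw [dist_comm]
    exact le_of_mul_le_mul_left (by linarith [hgx x' hx']) hα
  refine ⟨x', hd, by linarith [mul_nonneg hα.le (dist_nonneg (x := x) (y := x'))], ?_⟩
  filter_upwards [isOpen_ball.mem_nhds (mem_ball.2 (hd.trans_lt hηr))] with z hz
  rw [dist_self, mul_zero, add_zero]
  exact h2 ⟨z, ball_subset_closedBall hz⟩

lemma isMVSupersolutionWrt_of_hupp_nonneg [CompleteSpace X]
    (hgeo : IsGeodesicWrt (univ : Set X) dist)
    (hH : ContinuousOn (fun q : X × ℝ × ℝ => H q.1 q.2.1 q.2.2)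
      ((univ : Set X) ×ˢ (univ : Set ℝ) ×ˢ Ici (0 : ℝ)))
    (hu : LocBddWrt univ u)
    (h : ∀ a b x : X, ∀ k c : ℝ, 0 ≤ k → 0 ≤ c →
      IsLocalMin (fun x => lscWrt univ u x + (k / 2 * dist a x ^ 2 + c * dist b x)) x →
      0 ≤ Hupp H c x (lscWrt univ u x) (k * dist a x)) :
    IsMVSupersolutionWrt univ dist H u := by
  intro ψ₁ ψ₂ h₁ h₂ x _ hmin
  have hlsc := hu.lowerSemicontinuous_lscWrt
  set v := lscWrt univ u
  set p := slopeWrt univ dist ψ₁ x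
  set L := uscWrt univ (slopeWrt univ dist ψ₂) x
  have hp0 : 0 ≤ p := slopeWrt_nonneg _ _
  have hL0 : 0 ≤ L := uscWrt_slopeWrt_nonneg _ _
  rw [IsLocalMinOn, nhdsWithin_univ] at hmin
  have lip : ∀ ε > 0, ∃ R > 0, ∀ y ∈ ball x R,
      v x - (ψ₁ x + ψ₂ x) ≤ v y - (ψ₁ y + ψ₂ y) ∧ ψ₂ x - ψ₂ y ≤ (L + ε) * dist x y ∧
      v x - ε < v y ∧ ∀ z ∈ ball x R, ψ₁ z - ψ₁ y ≤ (p + ε) * dist y z := by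
    intro ε hε
    have hcont : ContinuousAt (slopeWrt univ dist ψ₁) x :=
      (continuousOn_univ.1 h₁.2.1).continuousAt
    obtain ⟨R₁, hR₁, hψ₁⟩ := h₁.1.exists_ball_lipschitz hgeo (x := x) (K := p + ε)
      (hcont.eventually_lt_const (lt_add_of_pos_right _ hε))
    obtain ⟨R₂, hR₂, hψ₂⟩ := h₂.exists_ball_lipschitz hgeo (x := x) (K := L + ε)
      (h₂.eventually_slopeWrt_lt (lt_add_of_pos_right _ hε))
    obtain ⟨R₃, hR₃, hv⟩ := Metric.eventually_nhds_iff_ball.1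
      (hmin.and (hlsc x (v x - ε) (sub_lt_self _ hε)))
    refine ⟨min R₁ (min R₂ R₃), by positivity, fun y hy => ?_⟩
    simp only [mem_ball, lt_inf_iff] at hy
    refine ⟨(hv y hy.2.2).1, ?_, (hv y hy.2.2).2, fun z hz => hψ₁ y hy.1 z ?_⟩
    · rw [dist_comm]
      exact hψ₂ y hy.2.1 x (mem_ball_self hR₂)
    · exact lt_of_lt_of_le (mem_ball.1 hz) (min_le_left _ _)
  rcases hp0.eq_or_lt with hp0' | hppos
  · rw [← hp0'] at lip ⊢
    refine Hupp_nonneg_of_approx hH fun ε hε => ?_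
    obtain ⟨R, hR, hball⟩ := lip (ε / 2) (by positivity)
    refine ⟨L + ε, x, v x, 0 * dist x x, by positivity, by simp, le_rfl, by simp [hε.le],
      by simp [hε.le], by simp [hε.le], h x x x 0 (L + ε) le_rfl (by positivity) ?_⟩
    filter_upwards [ball_mem_nhds x hR] with y hy
    obtain ⟨e1, e2, -, e3⟩ := hball y hy
    have e4 := e3 x (mem_ball_self hR)
    rw [dist_comm y x] at e4
    rw [dist_self]
    linarith
  refine Hupp_nonneg_of_approx hH fun ε hε => ?_
  obtain ⟨α, hα, hα1, hα2, hα3⟩ : ∃ α : ℝ, 0 < α ∧ α < 1 / 4 ∧ α * (3 * p + 2) ≤ ε ∧ α < p := by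
    have hq : 0 < ε / (3 * p + 2) := by positivity
    refine ⟨min (1 / 5) (min (ε / (3 * p + 2)) (p / 2)), by positivity, ?_, ?_, ?_⟩
    · exact (min_le_left _ _).trans_lt (by norm_num)
    · rw [← le_div_iff₀ (by positivity)]
      exact (min_le_right _ _).trans (min_le_left _ _)
    · exact ((min_le_right _ _).trans (min_le_right _ _)).trans_lt (by linarith)
  have hαε : α ^ 2 < α := by nlinarith
  obtain ⟨R, hR, hball⟩ := lip (α ^ 2) (by positivity)
  obtain ⟨y, hr, hyR, hy⟩ := h₁.exists_far_growth hppos (ε := α ^ 2)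
    (δ := min (R / 4) (min ε (ε / p))) (by positivity) (by linarith) (by positivity)
  simp only [lt_inf_iff] at hyR
  obtain ⟨hyR, hyε, hyp⟩ := hyR
  set r := dist y x with hr_def
  rw [lt_div_iff₀ hppos] at hyp
  set k := p / r with hk_def
  have hk : 0 < k := by positivity
  have hkr : k * r = p := div_mul_cancel₀ _ hr.ne'
  set g : X → ℝ := fun z => v z + (k / 2 * dist y z ^ 2 + (L + α ^ 2) * dist x z) with hg_def
  have hg : LowerSemicontinuous g := hlsc.add (Continuous.lowerSemicontinuous (by fun_prop))
  have hgx : g x = v x + p * r / 2 := by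
    simp only [hg_def, dist_self, ← hr_def]
    linear_combination r / 2 * hkr
  have hyball : y ∈ ball x R := by
    rw [mem_ball, ← hr_def]
    linarith
  obtain ⟨x', hd, hgle, hloc⟩ := hg.exists_isLocalMin_add_dist (x := x) (r := r) (α := α)
    (η := 3 * α * r) hα (by positivity) (by nlinarith) (by
      intro z hz
      have hzr : dist z x ≤ r := hz
      obtain ⟨e1, e2, -, e3⟩ := hball z (mem_ball.2 (by linarith))
      have e4 := e3 y hyball
      have hs : dist y z ≤ 2 * r := by
        linarith [dist_triangle_right y z x]
      rw [dist_comm z y] at e4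
      rw [hgx]
      simp only [hg_def]
      set s := dist y z
      have e5 : p * s ≤ k / 2 * s ^ 2 + p * r / 2 := by
        have : k / 2 * (r - s) ^ 2 = k / 2 * s ^ 2 + p * r / 2 - p * s := by
          linear_combination (r / 2 - s) * hkr
        nlinarith [sq_nonneg (r - s)]
      have e6 : α ^ 2 * s ≤ α ^ 2 * (2 * r) := mul_le_mul_of_nonneg_left hs (by positivity)
      linarith)
  have hx'r : dist x' x ≤ r := hd.trans (by nlinarith)
  have hdy : |dist y x' - r| ≤ 3 * α * r := by
    have := abs_dist_sub_le x' x y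
    rw [dist_comm x' y, dist_comm x y] at this
    exact this.trans hd
  refine ⟨L + α ^ 2 + α, x', v x', k * dist y x', by positivity, by positivity, by nlinarith,
    by linarith, ?_, ?_, h y x' x' k (L + α ^ 2 + α) hk.le (by positivity) ?_⟩
  · have h1 := (hball x' (mem_ball.2 (by linarith))).2.2.1
    have h2 : v x' ≤ g x' := by
      simp only [hg_def]
      have : 0 ≤ k / 2 * dist y x' ^ 2 + (L + α ^ 2) * dist x x' := by positivity
      linarith
    rw [abs_le]
    constructor <;> nlinarith
  · have : k * dist y x' - p = k * (dist y x' - r) := by rw [mul_sub, hkr]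
    rw [this, abs_mul, abs_of_pos hk]
    have := mul_le_mul_of_nonneg_left hdy hk.le
    have e : k * (3 * α * r) = 3 * α * p := by linear_combination 3 * α * hkr
    nlinarith
  · filter_upwards [hloc] with z hz
    simp only [hg_def, dist_self] at hz ⊢
    have := mul_le_mul_of_nonneg_left (dist_triangle x x' z) (by positivity : 0 ≤ L + α ^ 2)
    linarith

end Characterization

/-- characterization of metric viscosity supersolutions on a (not
necessarily locally compact) complete geodesic space. -/
theorem stmt17 {X : Type*} [MetricSpace X] [CompleteSpace X]
    (hgeo : IsGeodesicWrt (univ : Set X) dist)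
    (H : X → ℝ → ℝ → ℝ)
    (hH : ContinuousOn (fun q : X × ℝ × ℝ => H q.1 q.2.1 q.2.2)
      ((univ : Set X) ×ˢ (univ : Set ℝ) ×ˢ Ici (0:ℝ)))
    (u : X → ℝ) (hu : LocBddWrt (univ : Set X) u) :
    (IsMVSupersolutionWrt (univ : Set X) dist H u ↔
      (∀ a b xhat : X, ∀ k c : ℝ, 0 ≤ k → 0 ≤ c →
        IsLocalMin
          (fun x => lscWrt (univ : Set X) u x + (k / 2 * dist a x ^ 2 + c * dist b x)) xhat →
        0 ≤ Hupp H c xhat (lscWrt (univ : Set X) u xhat) (k * dist a xhat))) ∧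
    ((∀ a b xhat : X, ∀ k c : ℝ, 0 ≤ k → 0 ≤ c →
        IsLocalMin
          (fun x => lscWrt (univ : Set X) u x + (k / 2 * dist a x ^ 2 + c * dist b x)) xhat →
        0 ≤ Hupp H c xhat (lscWrt (univ : Set X) u xhat) (k * dist a xhat)) ↔
      (∀ a b xhat : X, ∀ k c : ℝ, 0 ≤ k → 0 ≤ c →
        IsStrictLocalMinOn'
          (fun x => lscWrt (univ : Set X) u x + (k / 2 * dist a x ^ 2 + c * dist b x))
          univ xhat →
        0 ≤ Hupp H c xhat (lscWrt (univ : Set X) u xhat) (k * dist a xhat))) := by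
  refine ⟨⟨fun hsuper a b x k c hk hc hmin => hsuper.hupp_nonneg hgeo hH hk hc hmin,
    isMVSupersolutionWrt_of_hupp_nonneg hgeo hH hu⟩,
    fun h a b x k c hk hc hmin => h a b x k c hk hc ?_,
    fun h a b x k c hk hc hmin => hupp_nonneg_of_strict hH h hk hc hmin⟩
  rw [IsStrictLocalMinOn', ← compl_eq_univ_sdiff, eventually_nhdsWithin_iff] at hmin
  filter_upwards [hmin] with y hy
  rcases eq_or_ne y x with rfl | hne
  · exact le_rfl
  · exact (hy hne).le
end

section
/- Under the noncompact stability setup with hypotheses (H1), (H2), (H3) and (H4⁺), suppose for each n ∈ ℕ the function u^n : X_n → ℝ is a metric viscosity subsolution of H_n(x, u^n, |∇_{d_n} u^n|) = 0 on (X_n, d_n), and the family (u^n) is uniformly bounded. Then the upper semilimit ū(x) := sup{ limsup_{n→∞} u^n(x_n) : x_n ∈ X_n, 𝖽(x_n, x) → 0 }, defined for x ∈ X_∞, is a metric viscosity subsolution of H_∞(x, ū, |∇_{d_∞} ū|) = 0 on (X_∞, d_∞). -/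
open Filter Metric Set Topology

namespace IsMetricOn

variable {Y : Type*} [MetricSpace Y] {S : Set Y} {ρ : Y → Y → ℝ}

lemma nonneg (h : IsMetricOn S ρ) {x y : Y} (hx : x ∈ S) (hy : y ∈ S) : 0 ≤ ρ x y :=
  dist_nonneg.trans (h.ge_dist x hx y hy)

lemma pos_of_ne (h : IsMetricOn S ρ) {x y : Y} (hx : x ∈ S) (hy : y ∈ S) (hxy : x ≠ y) :
    0 < ρ x y :=
  (dist_pos.2 hxy).trans_le (h.ge_dist x hx y hy)

lemma abs_sub_le (h : IsMetricOn S ρ) {x y z : Y} (hx : x ∈ S) (hy : y ∈ S) (hz : z ∈ S) :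
    |ρ x z - ρ y z| ≤ ρ x y := by
  have h1 := h.triangle x hx y hy z hz
  have h2 := h.triangle y hy x hx z hz
  rw [h.symm y hy x hx] at h2
  rw [abs_le]
  constructor <;> linarith

lemma eventually_lt (h : IsMetricOn S ρ) {x : Y} (hx : x ∈ S) {ε : ℝ} (hε : 0 < ε) :
    ∀ᶠ y in 𝓝[S] x, y ∈ S ∧ ρ x y < ε :=
  (h.nhds_basis x hx).mem_of_mem hε

lemma eventually_iff (h : IsMetricOn S ρ) {x : Y} (hx : x ∈ S) {P : Y → Prop} :
    (∀ᶠ y in 𝓝[S] x, P y) ↔ ∃ ε > 0, ∀ y ∈ S, ρ x y < ε → P y := by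
  rw [(h.nhds_basis x hx).eventually_iff]
  simp only [mem_ofPred_eq, and_imp]

lemma continuousOn_left (h : IsMetricOn S ρ) {z : Y} (hz : z ∈ S) :
    ContinuousOn (fun x => ρ x z) S := by
  intro x hx
  refine Metric.tendsto_nhds.2 fun ε hε => ?_
  filter_upwards [h.eventually_lt hx hε] with y hy
  rw [Real.dist_eq]
  refine (h.abs_sub_le hy.1 hx hz).trans_lt ?_
  rw [h.symm y hy.1 x hx]
  exact hy.2

lemma continuousOn_right (h : IsMetricOn S ρ) {z : Y} (hz : z ∈ S) :
    ContinuousOn (fun x => ρ z x) S :=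
  (h.continuousOn_left hz).congr fun x hx => h.symm z hz x hx

/-- Ekeland's variational principle on a closed ball, for an upper semicontinuous function. -/
theorem exists_ekeland [CompleteSpace Y] (h : IsMetricOn S ρ) (hS : IsClosed S) {f : Y → ℝ}
    (hf : UpperSemicontinuousOn f S) {x₀ : Y} (hx₀ : x₀ ∈ S) {r η θ : ℝ} (hr : 0 ≤ r) (hη : 0 < η)
    (hmax : ∀ x ∈ S, ρ x₀ x ≤ r → f x ≤ f x₀ + θ) :
    ∃ z ∈ S, ρ x₀ z ≤ r ∧ η * ρ x₀ z ≤ θ ∧ f x₀ ≤ f z ∧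
      ∀ x ∈ S, ρ x₀ x ≤ r → f x ≤ f z + η * ρ x z := by
  set A : Set Y := S ∩ {x | ρ x₀ x ≤ r} with hA
  have hAcl : IsClosed A :=
    (h.continuousOn_right hx₀).preimage_isClosed_of_isClosed hS isClosed_Iic
  have hstep : ∀ (k : ℕ) (x : Y), ∃ x', x ∈ A → x' ∈ A ∧ f x + η * ρ x x' ≤ f x' ∧
      ∀ y ∈ A, f x + η * ρ x y ≤ f y → f y ≤ f x' + (1 / 2 : ℝ) ^ k := by
    intro k x
    by_cases hx : x ∈ A
    swap
    · exact ⟨x, fun h => absurd h hx⟩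
    set G : Set Y := {y | y ∈ A ∧ f x + η * ρ x y ≤ f y} with hG
    have hxG : x ∈ G := ⟨hx, by rw [h.refl x hx.1]; simp⟩
    have hbdd : BddAbove (f '' G) := by
      refine ⟨f x₀ + θ, ?_⟩
      rintro _ ⟨y, hy, rfl⟩
      exact hmax y hy.1.1 hy.1.2
    obtain ⟨_, ⟨x', hx', rfl⟩, hlt⟩ := exists_lt_of_lt_csSup (s := f '' G)
      (b := sSup (f '' G) - (1 / 2 : ℝ) ^ k) ⟨_, x, hxG, rfl⟩ (by
        have : (0 : ℝ) < (1 / 2 : ℝ) ^ k := by positivity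
        linarith)
    refine ⟨x', fun _ => ⟨hx'.1, hx'.2, fun y hy hxy => ?_⟩⟩
    have := le_csSup hbdd ⟨y, ⟨hy, hxy⟩, rfl⟩
    linarith
  choose g hg using hstep
  obtain ⟨s, hs0, hss⟩ : ∃ s : ℕ → Y, s 0 = x₀ ∧ ∀ k, s (k + 1) = g k (s k) :=
    ⟨fun n => Nat.rec x₀ (fun k x => g k x) n, rfl, fun _ => rfl⟩
  have hx₀A : x₀ ∈ A := ⟨hx₀, by simpa [h.refl x₀ hx₀] using hr⟩
  have hsA : ∀ n, s n ∈ A := by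
    intro n
    induction n with
    | zero => exact hs0 ▸ hx₀A
    | succ k ih => exact hss k ▸ (hg k _ ih).1
  have hs1 : ∀ k, f (s k) + η * ρ (s k) (s (k + 1)) ≤ f (s (k + 1)) :=
    fun k => hss k ▸ (hg k _ (hsA k)).2.1
  have hs2 : ∀ k, ∀ y ∈ A, f (s k) + η * ρ (s k) y ≤ f y →
      f y ≤ f (s (k + 1)) + (1 / 2 : ℝ) ^ k := fun k => hss k ▸ (hg k _ (hsA k)).2.2
  have htrans : ∀ a ∈ A, ∀ b ∈ A, ∀ c ∈ A, f a + η * ρ a b ≤ f b → f b + η * ρ b c ≤ f c →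
      f a + η * ρ a c ≤ f c := by
    intro a ha b hb c hc hab hbc
    have := mul_le_mul_of_nonneg_left (h.triangle a ha.1 b hb.1 c hc.1) hη.le
    linarith
  have hs3 : ∀ j m, f (s j) + η * ρ (s j) (s (j + m)) ≤ f (s (j + m)) := by
    intro j m
    induction m with
    | zero => simp [h.refl _ (hsA j).1]
    | succ m ih => exact htrans _ (hsA _) _ (hsA _) _ (hsA _) ih (hs1 _)
  have hcauchy : CauchySeq fun k => s (k + 1) := by
    refine cauchySeq_of_le_geometric (1 / 2) (1 / η) (by norm_num) fun k => ?_
    refine (h.ge_dist _ (hsA _).1 _ (hsA _).1).trans ?_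
    have h1 := hs1 (k + 1)
    have h2 := hs2 k (s (k + 1 + 1)) (hsA _) (hs3 k 2)
    rw [one_div_mul_eq_div, le_div_iff₀ hη]
    linarith
  obtain ⟨z, hz⟩ := cauchySeq_tendsto_of_complete hcauchy
  have hzA : z ∈ A := hAcl.mem_of_tendsto hz (Eventually.of_forall fun k => hsA _)
  have hz' : Tendsto s atTop (𝓝[S] z) :=
    tendsto_nhdsWithin_iff.2 ⟨(tendsto_add_atTop_iff_nat 1).1 hz,
      Eventually.of_forall fun k => (hsA k).1⟩
  have hsz : ∀ j, f (s j) + η * ρ (s j) z ≤ f z := by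
    intro j
    by_contra! hlt
    obtain ⟨L, hL1, hL2⟩ := exists_between hlt
    have h1 : ∀ᶠ k in atTop, f (s k) < L := hz'.eventually (hf z hzA.1 L hL1)
    have h2 : Tendsto (fun k => f (s j) + η * ρ (s j) (s k)) atTop
        (𝓝 (f (s j) + η * ρ (s j) z)) :=
      (((h.continuousOn_right (hsA j).1 z hzA.1).tendsto.comp hz').const_mul η).const_add _
    obtain ⟨k, hk1, hk2, hk3⟩ :=
      (h1.and ((h2.eventually (lt_mem_nhds hL2)).and (eventually_ge_atTop j))).exists
    have := hs3 j (k - j)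
    rw [Nat.add_sub_cancel' hk3] at this
    linarith
  have h0 : f x₀ + η * ρ x₀ z ≤ f z := hs0 ▸ hsz 0
  have hpos : 0 ≤ η * ρ x₀ z := mul_nonneg hη.le (h.nonneg hx₀ hzA.1)
  refine ⟨z, hzA.1, hzA.2, ?_, by linarith, fun y hy hyr => ?_⟩
  · have := hmax z hzA.1 hzA.2
    linarith
  · by_contra! hlt
    rw [h.symm y hy z hzA.1] at hlt
    have hyA : y ∈ A := ⟨hy, hyr⟩
    have hk : ∀ k : ℕ, f y ≤ f z + (1 / 2 : ℝ) ^ k := by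
      intro k
      have h1 := hs2 k y hyA (htrans _ (hsA k) _ hzA _ hyA (hsz k) hlt.le)
      have h2 := hsz (k + 1)
      have h3 := mul_nonneg hη.le (h.nonneg (hsA (k + 1)).1 hzA.1)
      linarith
    have hlim : Tendsto (fun k : ℕ => f z + (1 / 2 : ℝ) ^ k) atTop (𝓝 (f z + 0)) :=
      (tendsto_pow_atTop_nhds_zero_of_lt_one (by norm_num) (by norm_num)).const_add _
    have h1 := ge_of_tendsto' hlim hk
    have h2 := mul_nonneg hη.le (h.nonneg hzA.1 hy)
    linarith

end IsMetricOn

section UscEnvelope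

variable {α : Type*} [TopologicalSpace α] {S : Set α} {u : α → ℝ} {x : α}

lemma LocBddWrt.isBoundedUnder_le (h : LocBddWrt S u) (hx : x ∈ S) :
    IsBoundedUnder (· ≤ ·) (𝓝[S] x) u := by
  obtain ⟨C, hC⟩ := h x hx
  exact ⟨C, eventually_map.2 (hC.mono fun y hy => (abs_le.1 hy).2)⟩

lemma LocBddWrt.isCoboundedUnder_le (h : LocBddWrt S u) (hx : x ∈ S) :
    IsCoboundedUnder (· ≤ ·) (𝓝[S] x) u := by
  obtain ⟨C, hC⟩ := h x hx
  have : (𝓝[S] x).NeBot := mem_closure_iff_nhdsWithin_neBot.1 (subset_closure hx)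
  exact IsBoundedUnder.isCoboundedUnder_le
    ⟨-C, eventually_map.2 (hC.mono fun y hy => (abs_le.1 hy).1)⟩

lemma LocBddWrt.le_uscWrt (h : LocBddWrt S u) (hx : x ∈ S) : u x ≤ uscWrt S u x := by
  refine le_limsup_of_frequently_le (fun hne => ?_) (h.isBoundedUnder_le hx)
  exact (hne.self_of_nhdsWithin hx) le_rfl

lemma LocBddWrt.uscWrt_le (h : LocBddWrt S u) (hx : x ∈ S) {a : ℝ}
    (ha : ∀ᶠ y in 𝓝[S] x, u y ≤ a) : uscWrt S u x ≤ a :=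
  limsup_le_of_le (h.isCoboundedUnder_le hx) ha

lemma LocBddWrt.eventually_lt (h : LocBddWrt S u) (hx : x ∈ S) {a : ℝ}
    (ha : uscWrt S u x < a) : ∀ᶠ y in 𝓝[S] x, u y < a :=
  eventually_lt_of_limsup_lt ha (h.isBoundedUnder_le hx)

lemma LocBddWrt.upperSemicontinuousOn_uscWrt (h : LocBddWrt S u) :
    UpperSemicontinuousOn (uscWrt S u) S := by
  intro x hx a ha
  obtain ⟨b, hb, hba⟩ := exists_between ha
  filter_upwards [eventually_eventually_nhdsWithin.2 (h.eventually_lt hx hb),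
    self_mem_nhdsWithin] with y hy hyS
  exact (h.uscWrt_le hyS (hy.mono fun _ => le_of_lt)).trans_lt hba

lemma locBddWrt_of_forall_abs_le {C : ℝ} (hC : ∀ x ∈ S, |u x| ≤ C) : LocBddWrt S u :=
  fun _ _ => ⟨C, eventually_mem_nhdsWithin.mono hC⟩

lemma abs_uscWrt_le {C : ℝ} (hC : ∀ x ∈ S, |u x| ≤ C) (hx : x ∈ S) : |uscWrt S u x| ≤ C := by
  have h := locBddWrt_of_forall_abs_le hC
  refine abs_le.2 ⟨(abs_le.1 (hC x hx)).1.trans (h.le_uscWrt hx), h.uscWrt_le hx ?_⟩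
  exact eventually_mem_nhdsWithin.mono fun y hy => (abs_le.1 (hC y hy)).2

end UscEnvelope

section LocalSlope

variable {Y : Type*} [MetricSpace Y] {S : Set Y} {ρ : Y → Y → ℝ} {u : Y → ℝ} {x : Y}

lemma LocLipWrt.exists_ball (hu : LocLipWrt S ρ u) (h : IsMetricOn S ρ) (hx : x ∈ S) :
    ∃ K ≥ 0, ∃ r > 0, ∀ y ∈ S, ∀ z ∈ S, ρ x y < r → ρ x z < r → |u y - u z| ≤ K * ρ y z := by
  obtain ⟨K, t, ht, hK⟩ := hu x hx
  obtain ⟨r, hr, hrt⟩ := (h.eventually_iff hx).1 ht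
  refine ⟨max K 0, le_max_right _ _, r, hr, fun y hy z hz hyr hzr => ?_⟩
  exact (hK y ⟨hrt y hy hyr, hy⟩ z ⟨hrt z hz hzr, hz⟩).trans
    (mul_le_mul_of_nonneg_right (le_max_left _ _) (h.nonneg hy hz))

lemma limsup_bot_real {α : Type*} (f : α → ℝ) : limsup f ⊥ = 0 := by
  simp [limsup_eq]

lemma IsMetricOn.eventually_div_le (h : IsMetricOn S ρ) (hx : x ∈ S) {v : Y → ℝ} {K : ℝ}
    (hv : ∀ᶠ y in 𝓝[S] x, v y ≤ K * ρ x y) :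
    ∀ᶠ y in 𝓝[S \ {x}] x, v y / ρ x y ≤ K := by
  filter_upwards [nhdsWithin_mono x sdiff_subset hv, self_mem_nhdsWithin] with y hy hyS
  exact (div_le_iff₀ (h.pos_of_ne hx hyS.1 (Ne.symm hyS.2))).2 hy

lemma IsMetricOn.eventually_div_nonneg (h : IsMetricOn S ρ) (hx : x ∈ S) {v : Y → ℝ}
    (hv : ∀ y, 0 ≤ v y) : ∀ᶠ y in 𝓝[S \ {x}] x, 0 ≤ v y / ρ x y := by
  filter_upwards [self_mem_nhdsWithin] with y hyS
  exact div_nonneg (hv y) (h.nonneg hx hyS.1)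

lemma IsMetricOn.limsup_div_le (h : IsMetricOn S ρ) (hx : x ∈ S) {v : Y → ℝ} {K : ℝ}
    (hK : 0 ≤ K) (hv0 : ∀ y, 0 ≤ v y) (hv : ∀ᶠ y in 𝓝[S] x, v y ≤ K * ρ x y) :
    limsup (fun y => v y / ρ x y) (𝓝[S \ {x}] x) ≤ K := by
  rcases eq_or_neBot (𝓝[S \ {x}] x) with hbot | hne
  · rw [hbot, limsup_bot_real]
    exact hK
  · exact limsup_le_of_le (IsBoundedUnder.isCoboundedUnder_le
      ⟨0, eventually_map.2 (h.eventually_div_nonneg hx hv0)⟩) (h.eventually_div_le hx hv)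

lemma IsMetricOn.limsup_div_nonneg (h : IsMetricOn S ρ) (hx : x ∈ S) {v : Y → ℝ} {K : ℝ}
    (hv0 : ∀ y, 0 ≤ v y) (hv : ∀ᶠ y in 𝓝[S] x, v y ≤ K * ρ x y) :
    0 ≤ limsup (fun y => v y / ρ x y) (𝓝[S \ {x}] x) := by
  rcases eq_or_neBot (𝓝[S \ {x}] x) with hbot | hne
  · rw [hbot, limsup_bot_real]
  · exact le_limsup_of_frequently_le (h.eventually_div_nonneg hx hv0).frequently
      ⟨K, eventually_map.2 (h.eventually_div_le hx hv)⟩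

lemma LocLipWrt.eventually_abs_sub_le (hu : LocLipWrt S ρ u) (h : IsMetricOn S ρ) (hx : x ∈ S) :
    ∃ K ≥ 0, ∀ᶠ y in 𝓝[S] x, |u y - u x| ≤ K * ρ x y := by
  obtain ⟨K, hK0, r, hr, hK⟩ := hu.exists_ball h hx
  refine ⟨K, hK0, (h.eventually_iff hx).2 ⟨r, hr, fun y hy hyr => ?_⟩⟩
  rw [h.symm x hx y hy]
  exact hK y hy x hx hyr (by rwa [h.refl x hx])

lemma LocLipWrt.slopeWrt_nonneg (hu : LocLipWrt S ρ u) (h : IsMetricOn S ρ) (hx : x ∈ S) :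
    0 ≤ slopeWrt S ρ u x := by
  obtain ⟨K, -, hK⟩ := hu.eventually_abs_sub_le h hx
  exact h.limsup_div_nonneg hx (fun _ => abs_nonneg _) hK

lemma IsMetricOn.slopeWrt_le (h : IsMetricOn S ρ) (hx : x ∈ S) {K r : ℝ} (hK : 0 ≤ K)
    (hr : 0 < r) (hu : ∀ y ∈ S, ρ x y < r → |u y - u x| ≤ K * ρ x y) :
    slopeWrt S ρ u x ≤ K :=
  h.limsup_div_le hx hK (fun _ => abs_nonneg _) ((h.eventually_iff hx).2 ⟨r, hr, hu⟩)

lemma LocLipWrt.locBddWrt_slopeWrt (hu : LocLipWrt S ρ u) (h : IsMetricOn S ρ) :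
    LocBddWrt S (slopeWrt S ρ u) := by
  intro x hx
  obtain ⟨K, hK0, r, hr, hK⟩ := hu.exists_ball h hx
  refine ⟨K, (h.eventually_iff hx).2 ⟨r, hr, fun y hy hyr => ?_⟩⟩
  rw [abs_of_nonneg (hu.slopeWrt_nonneg h hy)]
  refine h.slopeWrt_le hy hK0 (sub_pos.2 hyr) fun z hz hzr => ?_
  rw [h.symm y hy z hz]
  exact hK z hz y hy (by linarith [h.triangle x hx y hy z hz]) hyr

lemma LocLipWrt.uscWrt_slopeWrt_nonneg (hu : LocLipWrt S ρ u) (h : IsMetricOn S ρ)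
    (hx : x ∈ S) : 0 ≤ uscWrt S (slopeWrt S ρ u) x :=
  (hu.slopeWrt_nonneg h hx).trans ((hu.locBddWrt_slopeWrt h).le_uscWrt hx)

lemma IsMetricOn.tendsto_geodesic (h : IsMetricOn S ρ) {γ : ℝ → Y} {L : ℝ}
    (hγS : ∀ t ∈ Icc 0 L, γ t ∈ S)
    (hγ : ∀ s ∈ Icc 0 L, ∀ t ∈ Icc 0 L, ρ (γ s) (γ t) = |s - t|) {t : ℝ} (ht : t ∈ Ico 0 L) :
    Tendsto γ (𝓝[>] t) (𝓝[S \ {γ t}] (γ t)) := by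
  have htI : t ∈ Icc 0 L := Ico_subset_Icc_self ht
  have hI : ∀ᶠ s in 𝓝[>] t, s ∈ Ioo t L := Ioo_mem_nhdsGT ht.2
  rw [sdiff_eq, nhdsWithin_inter', tendsto_inf, tendsto_principal]
  constructor
  · rw [(h.nhds_basis _ (hγS t htI)).tendsto_right_iff]
    intro ε hε
    filter_upwards [hI, Ioo_mem_nhdsGT (lt_add_of_pos_right t hε)] with s hs hsε
    have hsI : s ∈ Icc 0 L := ⟨ht.1.trans hs.1.le, hs.2.le⟩
    refine ⟨hγS s hsI, ?_⟩
    rw [hγ t htI s hsI, abs_sub_comm, abs_of_pos (sub_pos.2 hs.1)]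
    linarith [hsε.2]
  · filter_upwards [hI] with s hs hst
    have hsI : s ∈ Icc 0 L := ⟨ht.1.trans hs.1.le, hs.2.le⟩
    have h1 := hγ t htI s hsI
    rw [mem_singleton_iff.1 hst, h.refl _ (hγS t htI), eq_comm, abs_eq_zero] at h1
    linarith [hs.1]

/-- A pointwise bound on the local slope gives a Lipschitz bound along geodesics. -/
lemma LocLipWrt.sub_le_of_slopeWrt_le (hu : LocLipWrt S ρ u) (h : IsMetricOn S ρ)
    (hg : IsGeodesicWrt S ρ) (hx : x ∈ S) {K r : ℝ}
    (hK : ∀ y ∈ S, ρ x y < 3 * r → slopeWrt S ρ u y ≤ K) {y z : Y} (hy : y ∈ S) (hz : z ∈ S)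
    (hyr : ρ x y < r) (hzr : ρ x z < r) : u z - u y ≤ K * ρ y z := by
  obtain ⟨γ, hγ0, hγ1, hγS, hγ⟩ := hg y hy z hz
  set L := ρ y z with hL
  have hL0 : 0 ≤ L := h.nonneg hy hz
  have h0I : (0 : ℝ) ∈ Icc 0 L := ⟨le_rfl, hL0⟩
  have hcont : ContinuousOn (fun t => u (γ t)) (Icc 0 L) := by
    intro t ht
    obtain ⟨K', hK'0, s, hs, hK'⟩ := hu.exists_ball h (hγS t ht)
    refine Metric.continuousWithinAt_iff.2 fun ε hε => ?_
    refine ⟨min s (ε / (K' + 1)), by positivity, fun {t'} ht' htt' => ?_⟩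
    have hd : ρ (γ t) (γ t') = dist t' t := by rw [hγ t ht t' ht', dist_comm, Real.dist_eq]
    have h1 := hK' (γ t') (hγS t' ht') (γ t) (hγS t ht)
      (by rw [hd]; exact htt'.trans_le (min_le_left _ _))
      (by rw [h.refl _ (hγS t ht)]; exact hs)
    rw [h.symm _ (hγS t' ht') _ (hγS t ht), hd] at h1
    have h2 : dist t' t < ε / (K' + 1) := htt'.trans_le (min_le_right _ _)
    rw [lt_div_iff₀ (by positivity)] at h2
    rw [Real.dist_eq]
    nlinarith [dist_nonneg (x := t') (y := t)]
  have hslope : ∀ t ∈ Ico 0 L, ∀ a : ℝ, K < a →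
      ∃ᶠ s in 𝓝[>] t, slope (fun t => u (γ t)) t s < a := by
    intro t ht a ha
    have htI : t ∈ Icc 0 L := Ico_subset_Icc_self ht
    have hball : ρ x (γ t) < 3 * r := by
      have h1 := h.triangle x hx y hy (γ t) (hγS t htI)
      have h2 := h.triangle y hy x hx z hz
      have h3 := hγ 0 h0I t htI
      rw [hγ0, zero_sub, abs_neg, abs_of_nonneg ht.1] at h3
      rw [h.symm y hy x hx, ← hL] at h2
      linarith [ht.2]
    obtain ⟨K', -, hK'⟩ := hu.eventually_abs_sub_le h (hγS t htI)
    have hev : ∀ᶠ w in 𝓝[S \ {γ t}] (γ t), |u w - u (γ t)| / ρ (γ t) w < a :=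
      eventually_lt_of_limsup_lt ((hK _ (hγS t htI) hball).trans_lt ha)
        ⟨K', eventually_map.2 (h.eventually_div_le (hγS t htI) hK')⟩
    refine Eventually.frequently ?_
    filter_upwards [(h.tendsto_geodesic hγS hγ ht).eventually hev, Ioo_mem_nhdsGT ht.2]
      with s hs hsI
    rw [hγ t htI s ⟨ht.1.trans hsI.1.le, hsI.2.le⟩, abs_sub_comm t s,
      abs_of_pos (sub_pos.2 hsI.1)] at hs
    rw [slope_def_field]
    exact (div_le_div_of_nonneg_right (le_abs_self _) (sub_pos.2 hsI.1).le).trans_lt hs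
  have := image_le_of_liminf_slope_right_le_deriv_boundary (B := fun t => u y + K * t)
    (B' := fun _ => K) hcont (by simp [hγ0]) (by fun_prop)
    (fun t _ => by simpa using (((hasDerivAt_id t).const_mul K).const_add (u y)).hasDerivWithinAt)
    hslope (right_mem_Icc.2 hL0)
  simp only [hγ1] at this
  linarith

lemma IsMetricOn.locLipWrt_const_mul (h : IsMetricOn S ρ) {z : Y} (hz : z ∈ S) {B : ℝ}
    (hB : 0 ≤ B) : LocLipWrt S ρ fun w => B * ρ w z := by
  refine fun x _ => ⟨B, univ, univ_mem, fun y hy w hw => ?_⟩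
  rw [← mul_sub, abs_mul, abs_of_nonneg hB]
  exact mul_le_mul_of_nonneg_left (h.abs_sub_le hy.2 hw.2 hz) hB

lemma IsMetricOn.uscWrt_slopeWrt_const_mul_le (h : IsMetricOn S ρ) {z : Y} (hz : z ∈ S) {B : ℝ}
    (hB : 0 ≤ B) (hx : x ∈ S) : uscWrt S (slopeWrt S ρ fun w => B * ρ w z) x ≤ B := by
  refine ((h.locLipWrt_const_mul hz hB).locBddWrt_slopeWrt h).uscWrt_le hx ?_
  filter_upwards [self_mem_nhdsWithin] with y hy
  refine h.slopeWrt_le hy hB one_pos fun w hw _ => ?_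
  rw [← mul_sub, abs_mul, abs_of_nonneg hB, h.symm y hy w hw]
  exact mul_le_mul_of_nonneg_left (h.abs_sub_le hw hy hz) hB

lemma IsMetricOn.abs_const_mul_sq_sub_le (h : IsMetricOn S ρ) {y z w : Y} (hy : y ∈ S)
    (hz : z ∈ S) (hw : w ∈ S) {c : ℝ} (hc : 0 ≤ c) :
    |c * ρ z y ^ 2 - c * ρ w y ^ 2| ≤ c * (ρ z y + ρ w y) * ρ z w := by
  have h1 : c * ρ z y ^ 2 - c * ρ w y ^ 2 = c * (ρ z y + ρ w y) * (ρ z y - ρ w y) := by ring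
  have h2 : 0 ≤ c * (ρ z y + ρ w y) :=
    mul_nonneg hc (add_nonneg (h.nonneg hz hy) (h.nonneg hw hy))
  rw [h1, abs_mul, abs_of_nonneg h2]
  exact mul_le_mul_of_nonneg_left (h.abs_sub_le hz hw hy) h2

lemma IsMetricOn.locLipWrt_const_mul_sq (h : IsMetricOn S ρ) {y : Y} (hy : y ∈ S) {c : ℝ}
    (hc : 0 ≤ c) : LocLipWrt S ρ fun w => c * ρ w y ^ 2 := by
  intro x hx
  refine ⟨c * (2 * (ρ x y + 1)), {w | w ∈ S ∧ ρ x w < 1}, h.eventually_lt hx one_pos, ?_⟩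
  rintro z ⟨⟨hz, hz1⟩, -⟩ w ⟨⟨hw, hw1⟩, -⟩
  refine (h.abs_const_mul_sq_sub_le hy hz hw hc).trans ?_
  refine mul_le_mul_of_nonneg_right (mul_le_mul_of_nonneg_left ?_ hc) (h.nonneg hz hw)
  have h1 := h.triangle z hz x hx y hy
  have h2 := h.triangle w hw x hx y hy
  rw [h.symm z hz x hx] at h1
  rw [h.symm w hw x hx] at h2
  linarith

lemma IsMetricOn.slopeWrt_const_mul_sq_le (h : IsMetricOn S ρ) {y : Y} (hx : x ∈ S)
    (hy : y ∈ S) {c : ℝ} (hc : 0 ≤ c) :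
    slopeWrt S ρ (fun w => c * ρ w y ^ 2) x ≤ 2 * c * ρ x y := by
  refine le_of_forall_pos_le_add fun ε hε => ?_
  have hxy := h.nonneg hx hy
  refine h.slopeWrt_le hx (r := ε / (c + 1)) (by positivity) (by positivity) fun w hw hwr => ?_
  refine (h.abs_const_mul_sq_sub_le hy hw hx hc).trans ?_
  rw [h.symm w hw x hx]
  refine mul_le_mul_of_nonneg_right ?_ (h.nonneg hx hw)
  have h1 := h.triangle w hw x hx y hy
  rw [h.symm w hw x hx] at h1
  have h2 := h.nonneg hx hw
  rw [lt_div_iff₀ (by positivity)] at hwr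
  nlinarith

lemma LocLipWrt.lowerSlopeWrt_le_slopeWrt (hu : LocLipWrt S ρ u) (h : IsMetricOn S ρ)
    (hx : x ∈ S) : lowerSlopeWrt S ρ u x ≤ slopeWrt S ρ u x := by
  obtain ⟨K, -, hK⟩ := hu.eventually_abs_sub_le h hx
  rcases eq_or_neBot (𝓝[S \ {x}] x) with hbot | hne
  · simp only [lowerSlopeWrt, slopeWrt, hbot, limsup_bot_real, le_refl]
  · refine limsup_le_limsup ?_ (IsBoundedUnder.isCoboundedUnder_le
      ⟨0, eventually_map.2 (h.eventually_div_nonneg hx fun _ => le_max_right _ _)⟩)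
      ⟨K, eventually_map.2 (h.eventually_div_le hx hK)⟩
    filter_upwards [self_mem_nhdsWithin] with y hy
    refine div_le_div_of_nonneg_right ?_ (h.nonneg hx hy.1)
    exact max_le (by rw [abs_sub_comm]; exact le_abs_self _) (abs_nonneg _)

lemma LocLipWrt.eventually_max_sub_le (hu : LocLipWrt S ρ u) (h : IsMetricOn S ρ) (hx : x ∈ S) :
    ∃ K, ∀ᶠ y in 𝓝[S] x, max (u x - u y) 0 ≤ K * ρ x y := by
  obtain ⟨K, -, hK⟩ := hu.eventually_abs_sub_le h hx
  refine ⟨K, hK.mono fun y hy => le_trans ?_ hy⟩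
  exact max_le (by rw [abs_sub_comm]; exact le_abs_self _) (abs_nonneg _)

lemma IsMetricOn.le_lowerSlopeWrt_const_mul_sq (h : IsMetricOn S ρ) (hg : IsGeodesicWrt S ρ)
    {y : Y} (hx : x ∈ S) (hy : y ∈ S) {c : ℝ} (hc : 0 ≤ c) :
    2 * c * ρ x y ≤ lowerSlopeWrt S ρ (fun w => c * ρ w y ^ 2) x := by
  obtain ⟨K, hK⟩ := (h.locLipWrt_const_mul_sq hy hc).eventually_max_sub_le h hx
  rcases (h.nonneg hx hy).eq_or_lt with h0 | h0
  · rw [← h0, mul_zero]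
    exact h.limsup_div_nonneg hx (fun _ => le_max_right _ _) hK
  obtain ⟨γ, hγ0, hγ1, hγS, hγ⟩ := hg x hx y hy
  set L := ρ x y with hL
  refine le_of_forall_pos_le_add fun ε hε => ?_
  rw [← sub_le_iff_le_add]
  refine le_limsup_of_frequently_le ?_ ⟨K, eventually_map.2 (h.eventually_div_le hx hK)⟩
  have ht := h.tendsto_geodesic hγS hγ (t := 0) ⟨le_rfl, h0⟩
  rw [hγ0] at ht
  refine ht.frequently (Eventually.frequently ?_)
  have hr : 0 < min L (ε / (c + 1)) := by positivity
  filter_upwards [Ioo_mem_nhdsGT hr] with t ht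
  have htL : t < L := ht.2.trans_le (min_le_left _ _)
  have htε : t < ε / (c + 1) := ht.2.trans_le (min_le_right _ _)
  have htI : t ∈ Icc 0 L := ⟨ht.1.le, htL.le⟩
  have h1 : ρ x (γ t) = t := by
    rw [← hγ0, hγ 0 ⟨le_rfl, h0.le⟩ t htI, zero_sub, abs_neg, abs_of_pos ht.1]
  have h2 : ρ (γ t) y = L - t := by
    rw [← hγ1, hγ t htI L ⟨h0.le, le_rfl⟩, abs_sub_comm, abs_of_pos (sub_pos.2 htL)]
  rw [h1, h2, le_div_iff₀ ht.1]
  refine le_trans ?_ (le_max_left _ _)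
  rw [lt_div_iff₀ (by positivity)] at htε
  nlinarith [ht.1]

lemma IsMetricOn.slopeWrt_const_mul_sq (h : IsMetricOn S ρ) (hg : IsGeodesicWrt S ρ)
    {y : Y} (hx : x ∈ S) (hy : y ∈ S) {c : ℝ} (hc : 0 ≤ c) :
    slopeWrt S ρ (fun w => c * ρ w y ^ 2) x = 2 * c * ρ x y :=
  (h.slopeWrt_const_mul_sq_le hx hy hc).antisymm
    ((h.le_lowerSlopeWrt_const_mul_sq hg hx hy hc).trans
      ((h.locLipWrt_const_mul_sq hy hc).lowerSlopeWrt_le_slopeWrt h hx))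

/-- On a geodesic space, multiples of the squared distance to a point are `C^{1,-}`. -/
lemma IsMetricOn.isC1MinusWrt_const_mul_sq (h : IsMetricOn S ρ) (hg : IsGeodesicWrt S ρ)
    {y : Y} (hy : y ∈ S) {c : ℝ} (hc : 0 ≤ c) : IsC1MinusWrt S ρ fun w => c * ρ w y ^ 2 := by
  refine ⟨h.locLipWrt_const_mul_sq hy hc, ?_, fun x hx => ?_⟩
  · exact ((h.continuousOn_left hy).const_smul (2 * c)).congr fun x hx =>
      h.slopeWrt_const_mul_sq hg hx hy hc
  · refine ((h.locLipWrt_const_mul_sq hy hc).lowerSlopeWrt_le_slopeWrt h hx).antisymm ?_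
    rw [h.slopeWrt_const_mul_sq hg hx hy hc]
    exact h.le_lowerSlopeWrt_const_mul_sq hg hx hy hc

end LocalSlope

section Testing

variable {Y : Type*} [MetricSpace Y] {S : Set Y} {ρ : Y → Y → ℝ}

lemma isCompact_nonneg_abs_sub_le (p a : ℝ) : IsCompact {q : ℝ | 0 ≤ q ∧ |q - p| ≤ a} := by
  have : {q : ℝ | 0 ≤ q ∧ |q - p| ≤ a} = Ici 0 ∩ closedBall p a := by
    ext q
    simp [Real.dist_eq]
  rw [this]
  exact (isCompact_closedBall p a).inter_left isClosed_Ici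

lemma continuousOn_hamiltonian {H : Y → ℝ → ℝ → ℝ}
    (hH : ContinuousOn (fun q : Y × ℝ × ℝ => H q.1 q.2.1 q.2.2)
      (S ×ˢ (univ : Set ℝ) ×ˢ Ici (0:ℝ))) {x : Y} (hx : x ∈ S) (s p a : ℝ) :
    ContinuousOn (H x s) {q | 0 ≤ q ∧ |q - p| ≤ a} :=
  hH.comp (f := fun q => (x, s, q)) (by fun_prop) fun _ hq => ⟨hx, mem_univ _, hq.1⟩

lemma IsMVSubsolutionWrt.exists_hamiltonian_nonpos {H : Y → ℝ → ℝ → ℝ} {u : Y → ℝ}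
    (hsub : IsMVSubsolutionWrt S ρ H u) (h : IsMetricOn S ρ) (hg : IsGeodesicWrt S ρ)
    (hH : ContinuousOn (fun q : Y × ℝ × ℝ => H q.1 q.2.1 q.2.2)
      (S ×ˢ (univ : Set ℝ) ×ˢ Ici (0:ℝ)))
    {y z : Y} (hy : y ∈ S) (hz : z ∈ S) {c B r : ℝ} (hc : 0 ≤ c) (hB : 0 ≤ B) (hr : 0 < r)
    (hmax : ∀ w ∈ S, ρ z w < r →
      uscWrt S u w ≤ uscWrt S u z + c * (ρ w y ^ 2 - ρ z y ^ 2) + B * ρ w z) :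
    ∃ q, 0 ≤ q ∧ |q - 2 * c * ρ z y| ≤ B ∧ H z (uscWrt S u z) q ≤ 0 := by
  have hlip := h.locLipWrt_const_mul hz hB
  have hloc := hsub _ _ (h.isC1MinusWrt_const_mul_sq hg hy hc) hlip z hz
    ((h.eventually_iff hz).2 ⟨r, hr, fun w hw hwr => by
      have := hmax w hw hwr
      simp only [h.refl z hz]
      linarith⟩)
  rw [h.slopeWrt_const_mul_sq hg hz hy hc] at hloc
  set a := uscWrt S (slopeWrt S ρ fun w => B * ρ w z) z with ha
  have ha0 : 0 ≤ a := hlip.uscWrt_slopeWrt_nonneg h hz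
  have haB : a ≤ B := h.uscWrt_slopeWrt_const_mul_le hz hB hz
  have hne : {q : ℝ | 0 ≤ q ∧ |q - 2 * c * ρ z y| ≤ a}.Nonempty :=
    ⟨2 * c * ρ z y, mul_nonneg (by positivity) (h.nonneg hz hy), by simpa using ha0⟩
  obtain ⟨q, hq, hqH⟩ := (isCompact_nonneg_abs_sub_le (2 * c * ρ z y) a).exists_sInf_image_eq hne
    (continuousOn_hamiltonian hH hz (uscWrt S u z) _ _)
  exact ⟨q, hq.1, hq.2.trans haB, hqH ▸ hloc⟩

/-- A local maximum of `v - (ψ₁ + ψ₂)` with `ψ₁` of class `C^{1,-}` and `ψ₂` locally Lipschitz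
can be approximated by local maxima of `v` minus a multiple of a squared distance and a cone,
with almost the same slopes. -/
theorem IsMetricOn.exists_approx_max [CompleteSpace Y] (h : IsMetricOn S ρ) (hS : IsClosed S)
    (hg : IsGeodesicWrt S ρ) {v ψ₁ ψ₂ : Y → ℝ} (hv : UpperSemicontinuousOn v S)
    (hψ₁ : IsC1MinusWrt S ρ ψ₁) (hψ₂ : LocLipWrt S ρ ψ₂) {x : Y} (hx : x ∈ S)
    (hmax : IsLocalMaxOn (fun w => v w - (ψ₁ w + ψ₂ w)) S x) {δ : ℝ} (hδ : 0 < δ) :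
    ∃ z ∈ S, ∃ y ∈ S, ∃ c B r : ℝ, 0 ≤ c ∧ 0 ≤ B ∧ 0 < r ∧ ρ x z < δ ∧ |v z - v x| < δ ∧
      |2 * c * ρ z y - slopeWrt S ρ ψ₁ x| ≤ δ ∧ B ≤ uscWrt S (slopeWrt S ρ ψ₂) x + δ ∧
      ∀ w ∈ S, ρ z w < r → v w ≤ v z + c * (ρ w y ^ 2 - ρ z y ^ 2) + B * ρ w z := by
  obtain ⟨hlip, hcont, hlow⟩ := hψ₁
  have hp := hlip.slopeWrt_nonneg h hx
  have ha := hψ₂.uscWrt_slopeWrt_nonneg h hx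
  set p := slopeWrt S ρ ψ₁ x with hp_def
  set a := uscWrt S (slopeWrt S ρ ψ₂) x with ha_def
  obtain ⟨s, hs0, hs1, hsδ⟩ : ∃ s : ℝ, 0 < s ∧ s ≤ 1 / 8 ∧ 8 * (p + 1) * s ≤ δ := by
    refine ⟨min (1 / 8) (δ / (8 * (p + 1))), by positivity, min_le_left _ _, ?_⟩
    rw [← le_div_iff₀' (by positivity)]
    exact min_le_right _ _
  have hss : s ^ 2 ≤ s / 8 := by nlinarith [mul_le_mul_of_nonneg_left hs1 hs0.le]
  have hε : 0 < s ^ 2 := by positivity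
  have hps : 0 ≤ p * s := by positivity
  have hsδ' : 8 * (p * s) + 8 * s ≤ δ := by linarith
  obtain ⟨r, hr, hball⟩ := (h.eventually_iff hx).1 (hmax.and
    (((hcont x hx).eventually (gt_mem_nhds (lt_add_of_pos_right _ hε))).and
      (((hψ₂.locBddWrt_slopeWrt h).eventually_lt hx (lt_add_of_pos_right _ hε)).and
        (hv x hx _ (lt_add_of_pos_right _ hδ)))))
  have hxr : ρ x x < r / 3 := by rw [h.refl x hx]; positivity
  have hL1 : ∀ w ∈ S, ∀ y ∈ S, ρ x w < r / 3 → ρ x y < r / 3 →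
      ψ₁ w - ψ₁ y ≤ (p + s ^ 2) * ρ y w := fun w hw y hy hwr hyr =>
    hlip.sub_le_of_slopeWrt_le h hg hx (r := r / 3)
      (fun t ht htr => (hball t ht (by linarith)).2.1.le) hy hw hyr hwr
  have hL2 : ∀ w ∈ S, ρ x w < r / 3 → ψ₂ w - ψ₂ x ≤ (a + s ^ 2) * ρ x w := fun w hw hwr =>
    hψ₂.sub_le_of_slopeWrt_le h hg hx (r := r / 3)
      (fun t ht htr => (hball t ht (by linarith)).2.2.1.le) hx hw hxr hwr
  have hL0 : ∀ w ∈ S, ρ x w < r / 3 → v w - (ψ₁ w + ψ₂ w) ≤ v x - (ψ₁ x + ψ₂ x) :=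
    fun w hw hwr => (hball w hw (by linarith)).1
  rcases eq_or_neBot (𝓝[S \ {x}] x) with hbot | hne
  · have hp0 : p = 0 := by rw [hp_def, slopeWrt, hbot, limsup_bot_real]
    have hev : ∀ᶠ w in 𝓝[S] x, w = x := by
      have : ∀ᶠ w in 𝓝[S \ {x}] x, False := by rw [hbot]; exact eventually_bot
      rw [sdiff_eq, nhdsWithin_inter', eventually_inf_principal] at this
      exact this.mono fun w hw => not_not.1 hw
    obtain ⟨r', hr', hall⟩ := (h.eventually_iff hx).1 hev
    refine ⟨x, hx, x, hx, 0, 0, r', le_rfl, le_rfl, hr', by rwa [h.refl x hx], by simpa using hδ,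
      by simpa [hp0] using hδ.le, by linarith, fun w hw hwr => ?_⟩
    rw [hall w hw hwr]
    simp
  obtain ⟨K, hK⟩ := hlip.eventually_max_sub_le h hx
  have hfreq : ∃ᶠ y in 𝓝[S \ {x}] x, p - s ^ 2 < max (ψ₁ x - ψ₁ y) 0 / ρ x y := by
    refine frequently_lt_of_lt_limsup (IsBoundedUnder.isCoboundedUnder_le
      ⟨0, eventually_map.2 (h.eventually_div_nonneg hx fun _ => le_max_right _ _)⟩) ?_
    change p - s ^ 2 < lowerSlopeWrt S ρ ψ₁ x
    rw [hlow x hx]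
    linarith
  have hnear : ∀ᶠ y in 𝓝[S \ {x}] x, y ∈ S ∧ ρ x y < min (r / 3) (δ / (p + 1)) :=
    nhdsWithin_mono x sdiff_subset (h.eventually_lt hx (by positivity))
  obtain ⟨y, hydrop, ⟨hy, hymin⟩, hySx⟩ :=
    (hfreq.and_eventually (hnear.and eventually_mem_nhdsWithin)).exists
  have hR : 0 < ρ x y := h.pos_of_ne hx hy (Ne.symm hySx.2)
  have hyr : ρ x y < r / 3 := hymin.trans_le (min_le_left _ _)
  have hRδ : ρ x y < δ / (p + 1) := hymin.trans_le (min_le_right _ _)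
  rw [lt_div_iff₀ (by positivity)] at hRδ
  set R := ρ x y with hR_def
  have hdrop : ψ₁ y - ψ₁ x ≤ -(p - 3 * s ^ 2) * R := by
    rw [lt_div_iff₀ hR] at hydrop
    rcases lt_max_iff.1 hydrop with h1 | h1
    · linarith [mul_pos hε hR]
    · have h2 := hL1 y hy x hx hyr hxr
      have h3 : p - s ^ 2 < 0 := by
        by_contra! h4
        exact absurd h1 (mul_nonneg h4 hR.le).not_gt
      linarith [mul_pos (neg_pos.2 h3) hR]
  set c := (p + s ^ 2) / (2 * R) with hc_def
  have hc : 0 ≤ c := by positivity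
  have hcR : 2 * c * R = p + s ^ 2 := by
    rw [hc_def]
    field_simp
  set f : Y → ℝ := fun w => v w - (c * ρ w y ^ 2 + (a + s ^ 2) * ρ w x) with hf_def
  have hf : UpperSemicontinuousOn f S := by
    have h1 : ContinuousOn (fun w => -(c * ρ w y ^ 2 + (a + s ^ 2) * ρ w x)) S :=
      ((((h.continuousOn_left hy).pow 2).const_smul c).add
        ((h.continuousOn_left hx).const_smul (a + s ^ 2))).neg
    exact hv.add h1.upperSemicontinuousOn
  have hfx : f x = v x - c * R ^ 2 := by simp [hf_def, h.refl x hx, hR_def]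
  have hfmax : ∀ w ∈ S, ρ x w ≤ r / 6 → f w ≤ f x + 4 * s ^ 2 * R := by
    intro w hw hwr
    have hwr' : ρ x w < r / 3 := by linarith
    have h0 := hL0 w hw hwr'
    have h1 := hL1 w hw y hy hwr' hyr
    have h2 := hL2 w hw hwr'
    rw [h.symm y hy w hw] at h1
    have h3 : (p + s ^ 2) * ρ w y ≤ c * (R ^ 2 + ρ w y ^ 2) := by
      rw [← hcR]
      linarith [mul_nonneg hc (sq_nonneg (R - ρ w y))]
    have h4 : c * R ^ 2 + c * R ^ 2 = (p + s ^ 2) * R := by rw [← hcR]; ring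
    rw [hfx, hf_def]
    simp only
    rw [h.symm w hw x hx]
    linarith
  obtain ⟨z, hz, -, hzθ, hfz, hzmax⟩ :=
    h.exists_ekeland hS hf hx (r := r / 6) (by positivity) hs0 hfmax
  have hzR : ρ x z ≤ 4 * s * R := by
    refine le_of_mul_le_mul_left (hzθ.trans_eq ?_) hs0
    ring
  have hzR2 : ρ x z ≤ R / 2 := by linarith [mul_le_mul_of_nonneg_right hs1 hR.le]
  have hzr : ρ x z < r / 6 := by linarith
  have hRδ' : R * p + R < δ := by linarith
  have hRp : 0 ≤ R * p := by positivity
  have hRs : s ^ 2 * R ≤ R := by nlinarith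
  refine ⟨z, hz, y, hy, c, a + s ^ 2 + s, r / 6 - ρ x z, hc, by positivity, by linarith,
    by linarith, ?_, ?_, by linarith, ?_⟩
  · have h1 := (hball z hz (by linarith)).2.2.2
    have h2 : v x - c * R ^ 2 ≤ v z := by
      rw [← hfx]
      refine hfz.trans ?_
      rw [hf_def]
      have := h.nonneg hz hx
      have : 0 ≤ c * ρ z y ^ 2 + (a + s ^ 2) * ρ z x := by positivity
      simp only
      linarith
    have h3 : c * R ^ 2 = (p + s ^ 2) * R / 2 := by rw [← hcR]; ring
    rw [abs_lt]
    constructor <;> linarith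
  · have h1 : |ρ z y - R| ≤ 4 * s * R := by
      refine (h.abs_sub_le hz hx hy).trans ?_
      rwa [h.symm z hz x hx]
    have h2 : 2 * c * ρ z y - p = s ^ 2 + 2 * c * (ρ z y - R) := by
      linear_combination hcR
    have h3 : |2 * c * (ρ z y - R)| ≤ (p + s ^ 2) * (4 * s) := by
      rw [abs_mul, abs_of_nonneg (by positivity), ← hcR]
      linarith [mul_le_mul_of_nonneg_left h1 hc]
    rw [h2]
    refine (abs_add_le _ _).trans ?_
    rw [abs_of_pos hε]
    linarith [mul_le_mul_of_nonneg_right (hss.trans (by linarith : s / 8 ≤ 1)) hs0.le]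
  · intro w hw hwr
    have h1 := hzmax w hw (by linarith [h.triangle x hx z hz w hw])
    have h2 := mul_le_mul_of_nonneg_left (h.triangle w hw z hz x hx) (by positivity : 0 ≤ a + s ^ 2)
    simp only [hf_def] at h1
    linarith

end Testing

section Extraction

/-- A property that holds for infinitely many `n` arbitrarily close to `x` holds infinitely often
along a sequence, with prescribed sets of values, that converges to `x`. -/
lemma exists_tendsto_frequently {Z : Type*} [PseudoMetricSpace Z] {X : ℕ → Set Z} {x : Z}
    (hX : ∃ b : ℕ → Z, (∀ n, b n ∈ X n) ∧ Tendsto b atTop (𝓝 x)) {P : ℝ → ℕ → Z → Prop}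
    (hP : ∀ δ > 0, ∀ N : ℕ, ∃ n ≥ N, ∃ w ∈ X n, dist w x < δ ∧ P δ n w)
    (hmono : ∀ n w δ δ', δ ≤ δ' → P δ n w → P δ' n w) :
    ∃ a : ℕ → Z, (∀ n, a n ∈ X n) ∧ Tendsto a atTop (𝓝 x) ∧ ∀ δ > 0, ∃ᶠ n in atTop, P δ n (a n) := by
  obtain ⟨b, hbX, hb⟩ := hX
  obtain ⟨σ, hσ, hσP⟩ := extraction_forall_of_frequently
    (P := fun k n => ∃ w ∈ X n, dist w x < 1 / ((k : ℝ) + 1) ∧ P (1 / ((k : ℝ) + 1)) n w)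
    (fun k => frequently_atTop.2 fun N => hP _ (by positivity) N)
  choose w hwX hwx hwP using hσP
  refine ⟨Function.extend σ w b, fun n => ?_, ?_, fun δ hδ => ?_⟩
  · by_cases hn : ∃ k, σ k = n
    · obtain ⟨k, rfl⟩ := hn
      rw [hσ.injective.extend_apply]
      exact hwX k
    · rw [Function.extend_apply' _ _ _ hn]
      exact hbX n
  · refine Metric.tendsto_atTop.2 fun ε hε => ?_
    obtain ⟨N, hN⟩ := Metric.tendsto_atTop.1 hb ε hε
    obtain ⟨K, hK⟩ := exists_nat_one_div_lt hε
    refine ⟨max N (σ K), fun n hn => ?_⟩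
    by_cases hk : ∃ k, σ k = n
    · obtain ⟨k, rfl⟩ := hk
      rw [hσ.injective.extend_apply]
      have hkK : K ≤ k := hσ.le_iff_le.1 ((le_max_right _ _).trans hn)
      exact (hwx k).trans ((Nat.one_div_le_one_div hkK).trans_lt hK)
    · rw [Function.extend_apply' _ _ _ hk]
      exact hN n ((le_max_left _ _).trans hn)
  · obtain ⟨K, hK⟩ := exists_nat_one_div_lt hδ
    refine frequently_atTop.2 fun N => ⟨σ (max N K), (le_max_left _ _).trans hσ.le_apply, ?_⟩
    rw [hσ.injective.extend_apply]
    exact hmono _ _ _ _ ((Nat.one_div_le_one_div (le_max_right N K)).trans hK.le) (hwP _)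

end Extraction

section Semilimit

variable {Y : Type*} [MetricSpace Y] {X : ℕ → Set Y} {u : ℕ → Y → ℝ} {x : Y} {C : ℝ}

/-- Upper semilimit of functions `u n` defined on varying sets `X n`. -/
noncomputable def upperSemilimit (X : ℕ → Set Y) (u : ℕ → Y → ℝ) (x : Y) : ℝ :=
  sSup {L : ℝ | ∃ xn : ℕ → Y, (∀ n, xn n ∈ X n) ∧ Tendsto xn atTop (𝓝 x) ∧
    limsup (fun n => u n (xn n)) atTop = L}

lemma abs_limsup_le {s : ℕ → ℝ} (hs : ∀ n, |s n| ≤ C) : |limsup s atTop| ≤ C := by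
  have hle : IsBoundedUnder (· ≤ ·) atTop s := isBoundedUnder_of ⟨C, fun n => (abs_le.1 (hs n)).2⟩
  have hge : IsBoundedUnder (· ≥ ·) atTop s :=
    isBoundedUnder_of ⟨-C, fun n => (abs_le.1 (hs n)).1⟩
  exact abs_le.2 ⟨le_limsup_of_frequently_le (Frequently.of_forall fun n => (abs_le.1 (hs n)).1) hle,
    limsup_le_of_le hge.isCoboundedUnder_le (Eventually.of_forall fun n => (abs_le.1 (hs n)).2)⟩

lemma bddAbove_limsup_set (hu : ∀ n, ∀ x ∈ X n, |u n x| ≤ C) :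
    BddAbove {L : ℝ | ∃ xn : ℕ → Y, (∀ n, xn n ∈ X n) ∧ Tendsto xn atTop (𝓝 x) ∧
      limsup (fun n => u n (xn n)) atTop = L} := by
  refine ⟨C, ?_⟩
  rintro _ ⟨xn, hxn, -, rfl⟩
  exact (abs_le.1 (abs_limsup_le fun n => hu n _ (hxn n))).2

lemma limsup_le_upperSemilimit (hu : ∀ n, ∀ x ∈ X n, |u n x| ≤ C) {xn : ℕ → Y}
    (hxn : ∀ n, xn n ∈ X n) (hx : Tendsto xn atTop (𝓝 x)) :
    limsup (fun n => u n (xn n)) atTop ≤ upperSemilimit X u x :=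
  le_csSup (bddAbove_limsup_set hu) ⟨xn, hxn, hx, rfl⟩

lemma abs_upperSemilimit_le
    (hX : ∃ b : ℕ → Y, (∀ n, b n ∈ X n) ∧ Tendsto b atTop (𝓝 x))
    (hu : ∀ n, ∀ x ∈ X n, |u n x| ≤ C) :
    |upperSemilimit X u x| ≤ C := by
  obtain ⟨b, hbX, hb⟩ := hX
  refine abs_le.2 ⟨(abs_le.1 (abs_limsup_le fun n => hu n _ (hbX n))).1.trans
    (limsup_le_upperSemilimit hu hbX hb), csSup_le ⟨_, b, hbX, hb, rfl⟩ ?_⟩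
  rintro _ ⟨xn, hxn, -, rfl⟩
  exact (abs_le.1 (abs_limsup_le fun n => hu n _ (hxn n))).2

lemma eventually_lt_of_upperSemilimit_lt
    (hX : ∃ b : ℕ → Y, (∀ n, b n ∈ X n) ∧ Tendsto b atTop (𝓝 x))
    (hu : ∀ n, ∀ x ∈ X n, |u n x| ≤ C)
    {L : ℝ} (hL : upperSemilimit X u x < L) :
    ∃ δ > 0, ∃ N, ∀ n ≥ N, ∀ w ∈ X n, dist w x < δ → u n w < L := by
  by_contra! hcon
  obtain ⟨a, haX, ha, hfr⟩ := exists_tendsto_frequently hX (P := fun _ n w => L ≤ u n w)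
    (fun δ hδ N => hcon δ hδ N) (fun _ _ _ _ _ h => h)
  have h1 : L ≤ limsup (fun n => u n (a n)) atTop := le_limsup_of_frequently_le (hfr 1 one_pos)
    (isBoundedUnder_of ⟨C, fun n => (abs_le.1 (hu n _ (haX n))).2⟩)
  linarith [limsup_le_upperSemilimit hu haX ha]

lemma eventually_uscWrt_le_of_upperSemilimit_lt
    (hX : ∃ b : ℕ → Y, (∀ n, b n ∈ X n) ∧ Tendsto b atTop (𝓝 x))
    (hu : ∀ n, ∀ x ∈ X n, |u n x| ≤ C)
    {L : ℝ} (hL : upperSemilimit X u x < L) :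
    ∃ δ > 0, ∃ N, ∀ n ≥ N, ∀ w ∈ X n, dist w x < δ → uscWrt (X n) (u n) w ≤ L := by
  obtain ⟨δ, hδ, N, hN⟩ := eventually_lt_of_upperSemilimit_lt hX hu hL
  refine ⟨δ, hδ, N, fun n hn w hw hwδ => ?_⟩
  refine (locBddWrt_of_forall_abs_le (hu n)).uscWrt_le hw ?_
  filter_upwards [self_mem_nhdsWithin,
    nhdsWithin_le_nhds (Metric.isOpen_ball.mem_nhds (Metric.mem_ball.2 hwδ))] with y hy hyδ
  exact (hN n hn y hy hyδ).le

lemma exists_tendsto_frequently_lt_upperSemilimit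
    (hX : ∃ b : ℕ → Y, (∀ n, b n ∈ X n) ∧ Tendsto b atTop (𝓝 x))
    (hu : ∀ n, ∀ x ∈ X n, |u n x| ≤ C) :
    ∃ a : ℕ → Y, (∀ n, a n ∈ X n) ∧ Tendsto a atTop (𝓝 x) ∧
      ∀ δ > 0, ∃ᶠ n in atTop, upperSemilimit X u x - δ < u n (a n) := by
  refine exists_tendsto_frequently hX (P := fun δ n w => upperSemilimit X u x - δ < u n w)
    (fun δ hδ N => ?_) (fun _ _ δ δ' h h' => by linarith)
  obtain ⟨b, hbX, hb⟩ := hX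
  obtain ⟨_, ⟨a, haX, ha, rfl⟩, hlt⟩ := exists_lt_of_lt_csSup
    (s := {L : ℝ | ∃ xn : ℕ → Y, (∀ n, xn n ∈ X n) ∧ Tendsto xn atTop (𝓝 x) ∧
      limsup (fun n => u n (xn n)) atTop = L})
    ⟨_, b, hbX, hb, rfl⟩ (sub_lt_self (upperSemilimit X u x) hδ)
  have hfr : ∃ᶠ n in atTop, upperSemilimit X u x - δ < u n (a n) :=
    frequently_lt_of_lt_limsup (IsBoundedUnder.isCoboundedUnder_le
      (isBoundedUnder_of ⟨-C, fun n => (abs_le.1 (hu n _ (haX n))).1⟩)) hlt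
  obtain ⟨n, hn, hnd, hnN⟩ := (hfr.and_eventually
    ((Metric.tendsto_nhds.1 ha δ hδ).and (eventually_ge_atTop N))).exists
  exact ⟨n, hnN, a n, haX n, hnd, hn⟩

end Semilimit

section SemilimitRegularity

variable {Y : Type*} [MetricSpace Y] {X : ℕ → Set Y} {Xi : Set Y} {u : ℕ → Y → ℝ} {C : ℝ}

lemma upperSemicontinuousOn_upperSemilimit
    (hX : ∀ x ∈ Xi, ∃ b : ℕ → Y, (∀ n, b n ∈ X n) ∧ Tendsto b atTop (𝓝 x))
    (hu : ∀ n, ∀ x ∈ X n, |u n x| ≤ C) : UpperSemicontinuousOn (upperSemilimit X u) Xi := by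
  intro x hx L hL
  obtain ⟨M, hM, hML⟩ := exists_between hL
  obtain ⟨δ, hδ, N, hN⟩ := eventually_lt_of_upperSemilimit_lt (hX x hx) hu hM
  filter_upwards [self_mem_nhdsWithin, nhdsWithin_le_nhds (Metric.ball_mem_nhds x hδ)] with y hy hyδ
  obtain ⟨a, haX, ha, hfr⟩ := exists_tendsto_frequently_lt_upperSemilimit (hX y hy) hu
  by_contra! hle
  obtain ⟨n, hn, hnδ, hnN⟩ := ((hfr (L - M) (sub_pos.2 hML)).and_eventually
    ((ha.eventually (Metric.isOpen_ball.mem_nhds hyδ)).and (eventually_ge_atTop N))).exists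
  have := hN n hnN (a n) (haX n) hnδ
  linarith

lemma uscWrt_upperSemilimit
    (hX : ∀ x ∈ Xi, ∃ b : ℕ → Y, (∀ n, b n ∈ X n) ∧ Tendsto b atTop (𝓝 x))
    (hu : ∀ n, ∀ x ∈ X n, |u n x| ≤ C) {x : Y} (hx : x ∈ Xi) :
    uscWrt Xi (upperSemilimit X u) x = upperSemilimit X u x := by
  have hb : LocBddWrt Xi (upperSemilimit X u) :=
    locBddWrt_of_forall_abs_le fun y hy => abs_upperSemilimit_le (hX y hy) hu
  refine le_antisymm (le_of_forall_gt_imp_ge_of_dense fun a ha => hb.uscWrt_le hx ?_)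
    (hb.le_uscWrt hx)
  exact (upperSemicontinuousOn_upperSemilimit hX hu x hx a ha).mono fun _ => le_of_lt

lemma exists_tendsto_of_tendsto_hausdorffDist (hne : ∀ n, (X n).Nonempty)
    (hfin : ∀ n, hausdorffEDist (X n) Xi ≠ ⊤)
    (hlim : Tendsto (fun n => hausdorffDist (X n) Xi) atTop (𝓝 0)) {x : Y} (hx : x ∈ Xi) :
    ∃ b : ℕ → Y, (∀ n, b n ∈ X n) ∧ Tendsto b atTop (𝓝 x) := by
  have hb : ∀ n : ℕ, ∃ b ∈ X n, dist x b < hausdorffDist (X n) Xi + 1 / ((n : ℝ) + 1) := by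
    intro n
    refine (infDist_lt_iff (hne n)).1 (lt_of_le_of_lt ?_ (lt_add_of_pos_right _ (by positivity)))
    rw [hausdorffDist_comm]
    exact infDist_le_hausdorffDist_of_mem hx (by rw [hausdorffEDist_comm]; exact hfin n)
  choose b hbX hbd using hb
  have h0 := hlim.add tendsto_one_div_add_atTop_nhds_zero_nat
  rw [add_zero] at h0
  refine ⟨b, hbX, tendsto_iff_dist_tendsto_zero.2 ?_⟩
  refine squeeze_zero (fun _ => dist_nonneg) (fun n => ?_) h0
  rw [dist_comm]
  exact (hbd n).le

end SemilimitRegularity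

section Stability

variable {Y : Type*} [MetricSpace Y] {X : ℕ → Set Y} {Xi : Set Y}
  {d : ℕ → Y → Y → ℝ} {di : Y → Y → ℝ} {H : ℕ → Y → ℝ → ℝ → ℝ} {Hi : Y → ℝ → ℝ → ℝ}
  {u : ℕ → Y → ℝ} {C : ℝ}

lemma Hlow_nonpos_of_frequently {x : Y} (hx : x ∈ Xi)
    (hX : ∃ b : ℕ → Y, (∀ n, b n ∈ X n) ∧ Tendsto b atTop (𝓝 x))
    (hHi : ContinuousOn (fun q : Y × ℝ × ℝ => Hi q.1 q.2.1 q.2.2)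
      (Xi ×ˢ (univ : Set ℝ) ×ˢ Ici (0:ℝ)))
    (h3 : ∀ xn : ℕ → Y, (∀ n, xn n ∈ X n) → Tendsto xn atTop (𝓝 x) →
      ∀ r p : ℝ, 0 ≤ p → ∀ rn pn : ℕ → ℝ, (∀ n, 0 ≤ pn n) →
      Tendsto rn atTop (𝓝 r) → Tendsto pn atTop (𝓝 p) →
      Tendsto (fun n => H n (xn n) (rn n) (pn n)) atTop (𝓝 (Hi x r p)))
    {s p a : ℝ}
    (hfr : ∀ δ > 0, ∀ N : ℕ, ∃ n ≥ N, ∃ z ∈ X n, dist z x < δ ∧ ∃ t, |t - s| < δ ∧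
      ∃ q, 0 ≤ q ∧ |q - p| ≤ a + δ ∧ H n z t q ≤ 0) :
    Hlow Hi a x s p ≤ 0 := by
  choose n hn z hzX hzx t hts q hq0 hqp hH using
    fun k : ℕ => hfr (1 / ((k : ℝ) + 1)) (by positivity) k
  have hlim : Tendsto (fun k : ℕ => a + 1 / ((k : ℝ) + 1)) atTop (𝓝 a) := by
    have := (tendsto_one_div_add_atTop_nhds_zero_nat (𝕜 := ℝ)).const_add a
    rwa [add_zero] at this
  have hone : ∀ k : ℕ, 1 / ((k : ℝ) + 1) ≤ 1 := fun k => by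
    rw [div_le_one (by positivity)]
    linarith [(Nat.cast_nonneg k : (0 : ℝ) ≤ k)]
  obtain ⟨q', hq', τ, hτ, hqlim⟩ := (isCompact_closedBall p (a + 1)).tendsto_subseq
    (x := q) fun k => by
      rw [mem_closedBall, Real.dist_eq]
      linarith [hqp k, hone k]
  have hq'0 : 0 ≤ q' := ge_of_tendsto' hqlim fun k => hq0 _
  have hq'p : |q' - p| ≤ a :=
    le_of_tendsto_of_tendsto' (hqlim.sub_const p).abs (hlim.comp hτ.tendsto_atTop)
      fun k => hqp _
  obtain ⟨b, hbX, hb⟩ := hX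
  obtain ⟨w, hwX, hw, hwH⟩ := exists_tendsto_frequently (Z := Y × ℝ × ℝ)
    (X := fun n => X n ×ˢ (univ : Set ℝ) ×ˢ Ici (0:ℝ)) (x := (x, s, q'))
    (P := fun _ n w => H n w.1 w.2.1 w.2.2 ≤ 0)
    ⟨fun n => (b n, s, q'), fun n => ⟨hbX n, mem_univ _, hq'0⟩,
      hb.prodMk_nhds tendsto_const_nhds⟩
    (fun δ hδ N => by
      obtain ⟨K, hK⟩ := exists_nat_one_div_lt hδ
      obtain ⟨k, hkq, hk⟩ := ((Metric.tendsto_nhds.1 hqlim δ hδ).and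
        (eventually_ge_atTop (max N K))).exists
      have hτk : max N K ≤ τ k := hk.trans hτ.le_apply
      have hsmall : 1 / ((τ k : ℝ) + 1) < δ :=
        (Nat.one_div_le_one_div ((le_max_right N K).trans hτk)).trans_lt hK
      refine ⟨n (τ k), ((le_max_left _ _).trans hτk).trans (hn _), (z (τ k), t (τ k), q (τ k)),
        ⟨hzX _, mem_univ _, hq0 _⟩, ?_, hH _⟩
      rw [Prod.dist_eq, Prod.dist_eq]
      exact max_lt ((hzx _).trans hsmall) (max_lt ((hts _).trans hsmall) hkq))
    (fun _ _ _ _ _ h => h)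
  have hlimH := h3 (fun n => (w n).1) (fun n => (hwX n).1) ((continuous_fst.tendsto _).comp hw)
    s q' hq'0 (fun n => (w n).2.1) (fun n => (w n).2.2) (fun n => (hwX n).2.2)
    (((continuous_fst.comp continuous_snd).tendsto _).comp hw)
    (((continuous_snd.comp continuous_snd).tendsto _).comp hw)
  have hle : Hi x s q' ≤ 0 := by
    by_contra! hpos
    obtain ⟨m, hm1, hm2⟩ := ((hwH 1 one_pos).and_eventually
      (hlimH.eventually (lt_mem_nhds hpos))).exists
    exact absurd hm1 hm2.not_ge
  have hcomp : IsCompact (Hi x s '' {q | 0 ≤ q ∧ |q - p| ≤ a}) :=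
    (isCompact_nonneg_abs_sub_le p a).image_of_continuousOn (continuousOn_hamiltonian hHi hx s p a)
  exact (csInf_le hcomp.bddBelow ⟨q', ⟨hq'0, hq'p⟩, rfl⟩).trans hle

variable [CompleteSpace Y]

/-- Transfer of a test by a squared distance plus a cone from the limit space to the
approximating spaces. -/
theorem exists_test_of_upperSemilimit_test
    (hXcl : ∀ n, IsClosed (X n)) (hmet : ∀ n, IsMetricOn (X n) (d n))
    (hgeo : ∀ n, IsGeodesicWrt (X n) (d n)) (hmeti : IsMetricOn Xi di)
    (hX : ∀ x ∈ Xi, ∃ b : ℕ → Y, (∀ n, b n ∈ X n) ∧ Tendsto b atTop (𝓝 x))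
    (hHc : ∀ n, ContinuousOn (fun q : Y × ℝ × ℝ => H n q.1 q.2.1 q.2.2)
      (X n ×ˢ (univ : Set ℝ) ×ˢ Ici (0:ℝ)))
    (h2 : ∀ a ∈ Xi, ∀ b ∈ Xi, ∀ an bn : ℕ → Y, (∀ n, an n ∈ X n) → (∀ n, bn n ∈ X n) →
      Tendsto an atTop (𝓝 a) → Tendsto bn atTop (𝓝 b) →
      Tendsto (fun n => d n (an n) (bn n)) atTop (𝓝 (di a b)))
    (h4p : ∀ a ∈ Xi, ∀ an : ℕ → Y, (∀ n, an n ∈ X n) → Tendsto an atTop (𝓝 a) →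
      ∀ φn : ℕ → Y → ℝ, ∀ φi : Y → ℝ,
      (∃ C : ℝ, ∀ n, ∀ x ∈ X n, |φn n x| ≤ C) → (∃ C : ℝ, ∀ x ∈ Xi, |φi x| ≤ C) →
      (∀ n, UpperSemicontinuousOn (φn n) (X n)) → UpperSemicontinuousOn φi Xi →
      (∀ x ∈ Xi, ∀ xn : ℕ → Y, (∀ n, xn n ∈ X n) → Tendsto xn atTop (𝓝 x) →
        Filter.limsup (fun n => φn n (xn n)) atTop ≤ φi x) →
      ∃ δ : ℝ, 0 < δ ∧ ∀ r : ℝ, 0 < r → r < δ →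
        Filter.limsup (fun n => sSup (φn n '' {x | x ∈ X n ∧ d n (an n) x ≤ r})) atTop ≤
          sSup (φi '' {x | x ∈ Xi ∧ di a x ≤ r}))
    (hsub : ∀ n, IsMVSubsolutionWrt (X n) (d n) (H n) (u n))
    (hu : ∀ n, ∀ x ∈ X n, |u n x| ≤ C)
    {x y : Y} (hx : x ∈ Xi) (hy : y ∈ Xi) {c B r₀ : ℝ} (hc : 0 ≤ c) (hB : 0 ≤ B) (hr₀ : 0 < r₀)
    (hmax : ∀ w ∈ Xi, di x w < r₀ → upperSemilimit X u w ≤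
      upperSemilimit X u x + c * (di w y ^ 2 - di x y ^ 2) + B * di w x)
    {δ : ℝ} (hδ : 0 < δ) (N : ℕ) :
    ∃ n ≥ N, ∃ z ∈ X n, dist z x < δ ∧ |uscWrt (X n) (u n) z - upperSemilimit X u x| < δ ∧
      ∃ q, 0 ≤ q ∧ |q - 2 * c * di x y| ≤ B + δ ∧ H n z (uscWrt (X n) (u n) z) q ≤ 0 := by
  obtain ⟨yn, hynX, hyn⟩ := hX y hy
  obtain ⟨xn, hxnX, hxn, hxfr⟩ := exists_tendsto_frequently_lt_upperSemilimit (hX x hx) hu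
  have husc : ∀ n, UpperSemicontinuousOn (uscWrt (X n) (u n)) (X n) := fun n =>
    (locBddWrt_of_forall_abs_le (hu n)).upperSemicontinuousOn_uscWrt
  have hvabs : ∀ w ∈ Xi, |upperSemilimit X u w| ≤ C := fun w hw => abs_upperSemilimit_le (hX w hw) hu
  have hC : 0 ≤ C := (abs_nonneg _).trans (hvabs x hx)
  set v := upperSemilimit X u with hv_def
  set D := di x y with hD_def
  have hD : 0 ≤ D := hmeti.nonneg hx hy
  set m := v x - c * D ^ 2 with hm_def
  set fn : ℕ → Y → ℝ := fun n w =>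
    uscWrt (X n) (u n) w - (c * d n w (yn n) ^ 2 + B * d n w (xn n)) with hfn_def
  set fi : Y → ℝ := fun w => v w - (c * di w y ^ 2 + B * di w x) with hfi_def
  have hfn : ∀ n, UpperSemicontinuousOn (fn n) (X n) := by
    intro n
    have h1 : ContinuousOn (fun w => -(c * d n w (yn n) ^ 2 + B * d n w (xn n))) (X n) :=
      (((((hmet n).continuousOn_left (hynX n)).pow 2).const_smul c).add
        (((hmet n).continuousOn_left (hxnX n)).const_smul B)).neg
    exact (husc n).add h1.upperSemicontinuousOn
  have hfi : UpperSemicontinuousOn fi Xi := by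
    have h1 : ContinuousOn (fun w => -(c * di w y ^ 2 + B * di w x)) Xi :=
      ((((hmeti.continuousOn_left hy).pow 2).const_smul c).add
        ((hmeti.continuousOn_left hx).const_smul B)).neg
    exact (upperSemicontinuousOn_upperSemilimit hX hu).add h1.upperSemicontinuousOn
  have hpen : ∀ n, ∀ w ∈ X n, 0 ≤ c * d n w (yn n) ^ 2 + B * d n w (xn n) := fun n w hw =>
    add_nonneg (by positivity) (mul_nonneg hB ((hmet n).nonneg hw (hxnX n)))
  have hbound : ∀ n, ∀ w ∈ X n, |max (fn n w) m| ≤ C + |m| := by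
    intro n w hw
    refine abs_le.2 ⟨?_, max_le ?_ ?_⟩
    · linarith [le_max_right (fn n w) m, neg_abs_le m]
    · have := (abs_le.1 (abs_uscWrt_le (hu n) hw)).2
      linarith [hpen n w hw, abs_nonneg m]
    · linarith [le_abs_self m]
  have hboundi : ∀ w ∈ Xi, |max (fi w) m| ≤ C + |m| := by
    intro w hw
    have h1 : 0 ≤ c * di w y ^ 2 + B * di w x :=
      add_nonneg (by positivity) (mul_nonneg hB (hmeti.nonneg hw hx))
    refine abs_le.2 ⟨?_, max_le ?_ ?_⟩
    · linarith [le_max_right (fi w) m, neg_abs_le m]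
    · linarith [(abs_le.1 (hvabs w hw)).2, abs_nonneg m]
    · linarith [le_abs_self m]
  have hlimsup : ∀ w ∈ Xi, ∀ wn : ℕ → Y, (∀ n, wn n ∈ X n) → Tendsto wn atTop (𝓝 w) →
      limsup (fun n => max (fn n (wn n)) m) atTop ≤ max (fi w) m := by
    intro w hw wn hwnX hwn
    refine le_of_forall_pos_le_add fun ε hε => limsup_le_of_le (IsBoundedUnder.isCoboundedUnder_le
      (isBoundedUnder_of ⟨m, fun n => le_max_right _ _⟩)) ?_
    obtain ⟨ε', hε', N', hN'⟩ := eventually_uscWrt_le_of_upperSemilimit_lt (hX w hw) hu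
      (lt_add_of_pos_right (v w) (half_pos hε))
    have hlim : Tendsto (fun n => c * d n (wn n) (yn n) ^ 2 + B * d n (wn n) (xn n)) atTop
        (𝓝 (c * di w y ^ 2 + B * di w x)) :=
      (((h2 w hw y hy wn yn hwnX hynX hwn hyn).pow 2).const_mul c).add
        ((h2 w hw x hx wn xn hwnX hxnX hwn hxn).const_mul B)
    filter_upwards [Metric.tendsto_nhds.1 hwn ε' hε', eventually_ge_atTop N',
      hlim.eventually (lt_mem_nhds (sub_lt_self _ (half_pos hε)))] with n hn1 hn2 hn3
    have h1 := hN' n hn2 (wn n) (hwnX n) hn1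
    refine max_le ?_ (by linarith [le_max_right (fi w) m])
    have h2 : fn n (wn n) ≤ fi w + ε := by
      simp only [hfn_def, hfi_def]
      linarith
    linarith [le_max_left (fi w) m]
  obtain ⟨δ₄, hδ₄, hsup⟩ := h4p x hx xn hxnX hxn (fun n w => max (fn n w) m)
    (fun w => max (fi w) m) ⟨_, hbound⟩ ⟨_, hboundi⟩
    (fun n => (hfn n).sup upperSemicontinuousOn_const) (hfi.sup upperSemicontinuousOn_const)
    hlimsup
  obtain ⟨r, hr, hrδ₄, hrr₀, hr1, hrδ⟩ : ∃ r : ℝ, 0 < r ∧ r < δ₄ ∧ r < r₀ ∧ r ≤ 1 ∧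
      r * (8 * ((c + 1) * (D + 4) + B)) ≤ δ := by
    have hM : 0 < 8 * ((c + 1) * (D + 4) + B) := by positivity
    refine ⟨min (min (δ₄ / 2) (r₀ / 2)) (min 1 (δ / (8 * ((c + 1) * (D + 4) + B)))),
      by positivity, ?_, ?_, ?_, ?_⟩
    · linarith [min_le_left (min (δ₄ / 2) (r₀ / 2))
        (min 1 (δ / (8 * ((c + 1) * (D + 4) + B)))), min_le_left (δ₄ / 2) (r₀ / 2)]
    · linarith [min_le_left (min (δ₄ / 2) (r₀ / 2))
        (min 1 (δ / (8 * ((c + 1) * (D + 4) + B)))), min_le_right (δ₄ / 2) (r₀ / 2)]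
    · exact (min_le_right _ _).trans (min_le_left _ _)
    · rw [← le_div_iff₀ hM]
      exact (min_le_right _ _).trans (min_le_right _ _)
  have hcDr : 0 ≤ c * D * r := by positivity
  have hcr : 0 ≤ c * r := by positivity
  have hDr : 0 ≤ D * r := by positivity
  have hBr : 0 ≤ B * r := by positivity
  have hrδ' : 8 * (c * D * r) + 32 * (c * r) + 8 * (D * r) + 32 * r + 8 * (B * r) ≤ δ := by
    linarith
  have hsupi : sSup ((fun w => max (fi w) m) '' {w | w ∈ Xi ∧ di x w ≤ r}) ≤ m := by
    refine csSup_le ⟨_, x, ⟨hx, by rw [hmeti.refl x hx]; exact hr.le⟩, rfl⟩ ?_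
    rintro _ ⟨w, ⟨hw, hwr⟩, rfl⟩
    refine max_le ?_ le_rfl
    have := hmax w hw (hwr.trans_lt hrr₀)
    simp only [hfi_def]
    linarith
  obtain ⟨θ, hθ⟩ : ∃ θ, θ = r * δ / 16 := ⟨_, rfl⟩
  have hθ0 : 0 < θ := by rw [hθ]; positivity
  have hθδ : θ ≤ δ / 16 := by
    linarith [mul_le_mul_of_nonneg_right hr1 hδ.le]
  have hbdd : ∀ n, BddAbove ((fun w => max (fn n w) m) '' {w | w ∈ X n ∧ d n (xn n) w ≤ r}) := by
    refine fun n => ⟨C + |m|, ?_⟩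
    rintro _ ⟨w, ⟨hw, -⟩, rfl⟩
    exact (abs_le.1 (hbound n w hw)).2
  have hself : ∀ n, xn n ∈ {w | w ∈ X n ∧ d n (xn n) w ≤ r} := fun n =>
    ⟨hxnX n, by rw [(hmet n).refl _ (hxnX n)]; exact hr.le⟩
  have hev : ∀ᶠ n in atTop,
      sSup ((fun w => max (fn n w) m) '' {w | w ∈ X n ∧ d n (xn n) w ≤ r}) < m + θ := by
    refine eventually_lt_of_limsup_lt (((hsup r hr hrδ₄).trans hsupi).trans_lt
      (lt_add_of_pos_right m hθ0)) (isBoundedUnder_of ⟨C + |m|, fun n => ?_⟩)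
    refine csSup_le ⟨_, xn n, hself n, rfl⟩ ?_
    rintro _ ⟨w, ⟨hw, -⟩, rfl⟩
    exact (abs_le.1 (hbound n w hw)).2
  have hDn := h2 x hx y hy xn yn hxnX hynX hxn hyn
  obtain ⟨n, hun, hnsup, hnD, hncD, hnx, hnN⟩ := ((hxfr θ hθ0).and_eventually (hev.and
    ((Metric.tendsto_nhds.1 hDn r hr).and ((((hDn.pow 2).const_mul c).eventually
      (gt_mem_nhds (lt_add_of_pos_right _ hθ0))).and ((Metric.tendsto_nhds.1 hxn r hr).and
        (eventually_ge_atTop N)))))).exists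
  have h := hmet n
  have hxX := hxnX n
  have hyX := hynX n
  rw [Real.dist_eq] at hnD
  have hfx : m - 2 * θ ≤ fn n (xn n) := by
    have := (locBddWrt_of_forall_abs_le (hu n)).le_uscWrt hxX
    simp only [hfn_def, h.refl _ hxX]
    linarith
  have hfle : ∀ w ∈ X n, d n (xn n) w ≤ r → fn n w ≤ m + θ := fun w hw hwr =>
    (le_max_left _ _).trans ((le_csSup (hbdd n) ⟨w, ⟨hw, hwr⟩, rfl⟩).trans hnsup.le)
  obtain ⟨z, hz, hzr, hzθ, hfz, hzmax⟩ := h.exists_ekeland (hXcl n) (hfn n) hxX hr.le (half_pos hδ)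
    (θ := 3 * θ) fun w hw hwr => by linarith [hfle w hw hwr]
  have hzr' : d n (xn n) z < r := by
    refine lt_of_mul_lt_mul_left (hzθ.trans_lt ?_) (half_pos hδ).le
    rw [hθ]
    linarith [mul_pos hr hδ]
  have hzy : |d n z (yn n) - D| ≤ 2 * r := by
    have h1 := h.abs_sub_le hz hxX hyX
    rw [h.symm z hz _ hxX] at h1
    have h3 := abs_sub_le (d n z (yn n)) (d n (xn n) (yn n)) D
    linarith
  obtain ⟨q, hq0, hqz, hqH⟩ := (hsub n).exists_hamiltonian_nonpos h (hgeo n) (hHc n) hyX hz hc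
    (B := B + δ / 2) (r := r - d n (xn n) z) (by positivity) (sub_pos.2 hzr') fun w hw hwr => by
      have h1 := hzmax w hw (by linarith [h.triangle _ hxX z hz w hw])
      have h3 := mul_le_mul_of_nonneg_left (h.triangle w hw z hz _ hxX) hB
      simp only [hfn_def] at h1
      linarith
  refine ⟨n, hnN, z, hz, ?_, ?_, q, hq0, ?_, hqH⟩
  · have h1 := h.ge_dist _ hxX z hz
    have h3 := dist_triangle_left z x (xn n)
    linarith
  · have h0 := h.nonneg hz hyX
    have hsq : |c * d n z (yn n) ^ 2 - c * D ^ 2| ≤ c * (2 * r * (2 * D + 2 * r)) := by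
      have h1 : c * d n z (yn n) ^ 2 - c * D ^ 2 =
          c * ((d n z (yn n) - D) * (d n z (yn n) + D)) := by ring
      rw [h1, abs_mul, abs_of_nonneg hc, abs_mul, abs_of_nonneg (add_nonneg h0 hD)]
      refine mul_le_mul_of_nonneg_left (mul_le_mul hzy ?_ (by positivity) (by positivity)) hc
      linarith [(abs_le.1 hzy).2]
    have hsq' : c * (2 * r * (2 * D + 2 * r)) ≤ δ / 2 := by
      linarith [mul_le_mul_of_nonneg_left hr1 hcr]
    obtain ⟨hsq1, hsq2⟩ := abs_le.1 (hsq.trans hsq')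
    have h1 := hfle z hz hzr
    have h3 := hfx.trans hfz
    simp only [hfn_def] at h1 h3
    rw [h.symm z hz _ hxX] at h1 h3
    have h4 := mul_le_mul_of_nonneg_left hzr hB
    have h5 := mul_nonneg hB (h.nonneg hxX hz)
    rw [abs_lt]
    constructor <;> linarith
  · have h1 : |2 * c * d n z (yn n) - 2 * c * D| ≤ 2 * c * (2 * r) := by
      rw [← mul_sub, abs_mul, abs_of_nonneg (by positivity : 0 ≤ 2 * c)]
      exact mul_le_mul_of_nonneg_left hzy (by positivity)
    have h3 := abs_sub_le q (2 * c * d n z (yn n)) (2 * c * D)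
    linarith

end Stability

/-- stability of metric viscosity subsolutions, noncompact case. -/
theorem stmt18 {Y : Type*} [MetricSpace Y] [CompleteSpace Y]
    (X : ℕ → Set Y) (Xi : Set Y)
    (d : ℕ → Y → Y → ℝ) (di : Y → Y → ℝ)
    (H : ℕ → Y → ℝ → ℝ → ℝ) (Hi : Y → ℝ → ℝ → ℝ)
    (u : ℕ → Y → ℝ)
    (hXne : ∀ n, (X n).Nonempty) (hXcl : ∀ n, IsClosed (X n))
    (hXine : Xi.Nonempty) (hXicl : IsClosed Xi)
    (hmet : ∀ n, IsMetricOn (X n) (d n)) (hgeo : ∀ n, IsGeodesicWrt (X n) (d n))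
    (hmeti : IsMetricOn Xi di) (hgeoi : IsGeodesicWrt Xi di)
    (hHc : ∀ n, ContinuousOn (fun q : Y × ℝ × ℝ => H n q.1 q.2.1 q.2.2)
      (X n ×ˢ (univ : Set ℝ) ×ˢ Ici (0:ℝ)))
    (hHic : ContinuousOn (fun q : Y × ℝ × ℝ => Hi q.1 q.2.1 q.2.2)
      (Xi ×ˢ (univ : Set ℝ) ×ˢ Ici (0:ℝ)))
    (h1fin : ∀ n, EMetric.hausdorffEdist (X n) Xi ≠ ⊤)
    (h1 : Tendsto (fun n => hausdorffDist (X n) Xi) atTop (𝓝 0))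
    (h2 : ∀ a ∈ Xi, ∀ b ∈ Xi, ∀ an bn : ℕ → Y, (∀ n, an n ∈ X n) → (∀ n, bn n ∈ X n) →
      Tendsto an atTop (𝓝 a) → Tendsto bn atTop (𝓝 b) →
      Tendsto (fun n => d n (an n) (bn n)) atTop (𝓝 (di a b)))
    (h3 : ∀ x ∈ Xi, ∀ xn : ℕ → Y, (∀ n, xn n ∈ X n) → Tendsto xn atTop (𝓝 x) →
      ∀ r p : ℝ, 0 ≤ p → ∀ rn pn : ℕ → ℝ, (∀ n, 0 ≤ pn n) →
      Tendsto rn atTop (𝓝 r) → Tendsto pn atTop (𝓝 p) →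
      Tendsto (fun n => H n (xn n) (rn n) (pn n)) atTop (𝓝 (Hi x r p)))
    (h4p : ∀ a ∈ Xi, ∀ an : ℕ → Y, (∀ n, an n ∈ X n) → Tendsto an atTop (𝓝 a) →
      ∀ φn : ℕ → Y → ℝ, ∀ φi : Y → ℝ,
      (∃ C : ℝ, ∀ n, ∀ x ∈ X n, |φn n x| ≤ C) → (∃ C : ℝ, ∀ x ∈ Xi, |φi x| ≤ C) →
      (∀ n, UpperSemicontinuousOn (φn n) (X n)) → UpperSemicontinuousOn φi Xi →
      (∀ x ∈ Xi, ∀ xn : ℕ → Y, (∀ n, xn n ∈ X n) → Tendsto xn atTop (𝓝 x) →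
        Filter.limsup (fun n => φn n (xn n)) atTop ≤ φi x) →
      ∃ δ : ℝ, 0 < δ ∧ ∀ r : ℝ, 0 < r → r < δ →
        Filter.limsup (fun n => sSup (φn n '' {x | x ∈ X n ∧ d n (an n) x ≤ r})) atTop ≤
          sSup (φi '' {x | x ∈ Xi ∧ di a x ≤ r}))
    (hsub : ∀ n, IsMVSubsolutionWrt (X n) (d n) (H n) (u n))
    (hbdd : ∃ C : ℝ, ∀ n, ∀ x ∈ X n, |u n x| ≤ C) :
    IsMVSubsolutionWrt Xi di Hi (fun x => sSup {L : ℝ | ∃ xn : ℕ → Y,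
      (∀ n, xn n ∈ X n) ∧ Tendsto xn atTop (𝓝 x) ∧
      Filter.limsup (fun n => u n (xn n)) atTop = L}) := by
  obtain ⟨C, hu⟩ := hbdd
  have hX : ∀ x ∈ Xi, ∃ b : ℕ → Y, (∀ n, b n ∈ X n) ∧ Tendsto b atTop (𝓝 x) := fun x hx =>
    exists_tendsto_of_tendsto_hausdorffDist hXne h1fin h1 hx
  change IsMVSubsolutionWrt Xi di Hi (upperSemilimit X u)
  intro ψ₁ ψ₂ hψ₁ hψ₂ x hx hmax
  rw [uscWrt_upperSemilimit hX hu hx]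
  have hmax' : IsLocalMaxOn (fun y => upperSemilimit X u y - (ψ₁ y + ψ₂ y)) Xi x := by
    filter_upwards [hmax, self_mem_nhdsWithin] with y hy hyX
    simpa only [uscWrt_upperSemilimit hX hu hyX, uscWrt_upperSemilimit hX hu hx] using hy
  refine Hlow_nonpos_of_frequently hx (hX x hx) hHic (h3 x hx) fun δ hδ N => ?_
  obtain ⟨z, hz, y, hy, c, B, r, hc, hB, hr, hxz, hvz, hslope, hBa, hzmax⟩ :=
    hmeti.exists_approx_max hXicl hgeoi (upperSemicontinuousOn_upperSemilimit hX hu) hψ₁ hψ₂ hx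
      hmax' (δ := δ / 3) (by positivity)
  obtain ⟨n, hnN, w, hw, hwz, hwv, q, hq0, hq, hH⟩ := exists_test_of_upperSemilimit_test hXcl hmet
    hgeo hmeti hX hHc h2 h4p hsub hu hz hy hc hB hr hzmax (δ := δ / 3) (by positivity) N
  refine ⟨n, hnN, w, hw, ?_, _, ?_, q, hq0, ?_, hH⟩
  · have h5 := hmeti.ge_dist x hx z hz
    have h6 := dist_triangle_right w x z
    linarith
  · have h5 := abs_sub_le (uscWrt (X n) (u n) w) (upperSemilimit X u z) (upperSemilimit X u x)
    linarith
  · have h5 := abs_sub_le q (2 * c * di z y) (slopeWrt Xi di ψ₁ x)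
    linarith
end
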